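/- arXiv:1410.7312 — 2 statements merged into one kernel-verified Lean document; each statement's English description precedes it below -/
import Mathlib

section
/- For permutations σ, τ with σ sum indecomposable, the patterns σ ⊕ τ and τ ⊕ σ are equipopular in the separable permutations (more generally, exchanging the subtrees rooted at two incomparable nodes of the decomposition tree preserves popularity). -/
open Equiv

def occursAt {k n : ℕ} (σ : Perm (Fin k)) (π : Perm (Fin n)) (f : Fin k → Fin n) : Prop :=
  StrictMono f ∧ ∀ i j, σ i < σ j ↔ π (f i) < π (f j)

noncomputable def occCount {k n : ℕ} (σ : Perm (Fin k)) (π : Perm (Fin n)) : ℕ :=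
  Nat.card {f : Fin k → Fin n // occursAt σ π f}

def Contains {k n : ℕ} (σ : Perm (Fin k)) (π : Perm (Fin n)) : Prop :=
  ∃ f, occursAt σ π f

def directSum {m n : ℕ} (σ : Perm (Fin m)) (τ : Perm (Fin n)) : Perm (Fin (m + n)) :=
  finSumFinEquiv.symm.trans ((Equiv.sumCongr σ τ).trans finSumFinEquiv)

def skewSum {m n : ℕ} (σ : Perm (Fin m)) (τ : Perm (Fin n)) : Perm (Fin (m + n)) :=
  finSumFinEquiv.symm.trans (((Equiv.sumCongr σ τ).trans (Equiv.sumComm (Fin m) (Fin n))).trans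
    (finSumFinEquiv.trans (finCongr (Nat.add_comm n m))))

inductive IsSepPerm : {n : ℕ} → Perm (Fin n) → Prop
  | single : IsSepPerm (1 : Perm (Fin 1))
  | dsum {m n : ℕ} {σ : Perm (Fin m)} {τ : Perm (Fin n)} :
      IsSepPerm σ → IsSepPerm τ → IsSepPerm (directSum σ τ)
  | ssum {m n : ℕ} {σ : Perm (Fin m)} {τ : Perm (Fin n)} :
      IsSepPerm σ → IsSepPerm τ → IsSepPerm (skewSum σ τ)

def SumDecomposable {n : ℕ} (π : Perm (Fin n)) : Prop :=
  ∃ (a b : ℕ) (h : a + b = n) (σ : Perm (Fin a)) (τ : Perm (Fin b)),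
    0 < a ∧ 0 < b ∧ π = ((finCongr h).symm.trans (directSum σ τ)).trans (finCongr h)

def SkewDecomposable {n : ℕ} (π : Perm (Fin n)) : Prop :=
  ∃ (a b : ℕ) (h : a + b = n) (σ : Perm (Fin a)) (τ : Perm (Fin b)),
    0 < a ∧ 0 < b ∧ π = ((finCongr h).symm.trans (skewSum σ τ)).trans (finCongr h)

def SumIndecomposable {n : ℕ} (π : Perm (Fin n)) : Prop := ¬ SumDecomposable π

open scoped Classical in
/-- Total number of occurrences of the pattern `σ` in all separable permutations of length `n`. -/
noncomputable def sepPop {k : ℕ} (σ : Perm (Fin k)) (n : ℕ) : ℕ :=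
  ∑ π : Perm (Fin n), if IsSepPerm π then occCount σ π else 0

/-- Binary trees whose internal nodes are labelled by a direct sum (`true`) or a skew sum
(`false`). -/
inductive SepTree : Type
  | leaf : SepTree
  | node (c : Bool) (l r : SepTree) : SepTree

/-- The direct sum (`true`) or the skew sum (`false`) of two permutations. -/
def combinePerm (c : Bool) {m n : ℕ} (σ : Perm (Fin m)) (τ : Perm (Fin n)) :
    Perm (Fin (m + n)) :=
  match c with
  | true => directSum σ τ
  | false => skewSum σ τ

/-- The direct sum (`true`) or the skew sum (`false`) of two permutations written as
lists of values. -/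
def combineList (c : Bool) (l₁ l₂ : List ℕ) : List ℕ :=
  match c with
  | true => l₁ ++ l₂.map (· + l₁.length)
  | false => l₁.map (· + l₂.length) ++ l₂

/-- The list of values of a permutation, starting at `0`. -/
def oneLine {n : ℕ} (π : Perm (Fin n)) : List ℕ := List.ofFn fun i => (π i : ℕ)

theorem length_oneLine {n : ℕ} (π : Perm (Fin n)) : (oneLine π).length = n := by
  simp [oneLine]

theorem oneLine_injective {n : ℕ} : Function.Injective (oneLine (n := n)) := by
  intro π ρ h
  have := List.ofFn_injective h
  ext i
  exact congrFun this i

theorem oneLine_combinePerm (c : Bool) {m n : ℕ} (σ : Perm (Fin m)) (τ : Perm (Fin n)) :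
    oneLine (combinePerm c σ τ) = combineList c (oneLine σ) (oneLine τ) := by
  have h (i : Fin m) (h : m ≤ m + n) : finSumFinEquiv.symm (Fin.castLE h i) = Sum.inl i :=
    finSumFinEquiv_symm_apply_castAdd i
  cases c
  · simp [oneLine, combinePerm, combineList, skewSum, List.ofFn_add, List.map_ofFn,
      Function.comp_def, Nat.add_comm, h]
  · simp [oneLine, combinePerm, combineList, directSum, List.ofFn_add, List.map_ofFn,
      Function.comp_def, Nat.add_comm, h]

theorem length_combineList (c : Bool) (l₁ l₂ : List ℕ) :
    (combineList c l₁ l₂).length = l₁.length + l₂.length := by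
  cases c <;> simp [combineList]

theorem combineList_assoc (c : Bool) (l₁ l₂ l₃ : List ℕ) :
    combineList c (combineList c l₁ l₂) l₃ = combineList c l₁ (combineList c l₂ l₃) := by
  cases c <;> simp [combineList, Function.comp_def] <;> intros <;> omega

namespace SepTree

def size : SepTree → ℕ
  | leaf => 1
  | node _ l r => l.size + r.size

def root : SepTree → Option Bool
  | leaf => none
  | node c _ _ => some c

/-- A tree is reduced if no left child carries the same label as its parent. -/
def Reduced : SepTree → Prop
  | leaf => True
  | node c l r => l.root ≠ some c ∧ l.Reduced ∧ r.Reduced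

def toPerm : (t : SepTree) → Perm (Fin t.size)
  | leaf => 1
  | node c l r => combinePerm c l.toPerm r.toPerm

def toList : SepTree → List ℕ
  | leaf => [0]
  | node c l r => combineList c l.toList r.toList

theorem oneLine_toPerm (t : SepTree) : oneLine t.toPerm = t.toList := by
  induction t with
  | leaf => simp [toPerm, toList, oneLine, size]
  | node c l r hl hr => rw [toPerm, toList, ← hl, ← hr]; exact oneLine_combinePerm c _ _

theorem length_toList (t : SepTree) : t.toList.length = t.size := by
  rw [← oneLine_toPerm, length_oneLine]

theorem size_pos (t : SepTree) : 0 < t.size := by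
  induction t with
  | leaf => exact Nat.one_pos
  | node c l r hl hr => exact Nat.add_pos_left hl _

theorem isSepPerm_toPerm (t : SepTree) : IsSepPerm t.toPerm := by
  induction t with
  | leaf => exact IsSepPerm.single
  | node c l r hl hr =>
    cases c
    · exact IsSepPerm.ssum hl hr
    · exact IsSepPerm.dsum hl hr

theorem exists_reduced_node (c : Bool) (s t : SepTree) (hs : s.Reduced) (ht : t.Reduced) :
    ∃ u : SepTree, u.Reduced ∧ u.toList = combineList c s.toList t.toList := by
  induction s with
  | leaf => exact ⟨node c leaf t, ⟨by simp [root], hs, ht⟩, rfl⟩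
  | node d l r _ hr =>
    by_cases hd : d = c
    · subst hd
      obtain ⟨u, hu, hul⟩ := hr hs.2.2
      exact ⟨node d l u, ⟨hs.1, hs.2.1, hu⟩, by
        rw [toList, hul, toList, combineList_assoc]⟩
    · exact ⟨node c (node d l r) t, ⟨by simpa [root] using hd, hs, ht⟩, rfl⟩

theorem exists_reduced_of_isSepPerm {n : ℕ} {π : Perm (Fin n)} (h : IsSepPerm π) :
    ∃ t : SepTree, t.Reduced ∧ t.toList = oneLine π := by
  induction h with
  | single => exact ⟨leaf, trivial, by simp [toList, oneLine]⟩
  | dsum _ _ h₁ h₂ =>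
    obtain ⟨s, hs, hs'⟩ := h₁
    obtain ⟨t, ht, ht'⟩ := h₂
    obtain ⟨u, hu, hu'⟩ := exists_reduced_node true s t hs ht
    exact ⟨u, hu, by rw [hu', hs', ht', ← oneLine_combinePerm]; rfl⟩
  | ssum _ _ h₁ h₂ =>
    obtain ⟨s, hs, hs'⟩ := h₁
    obtain ⟨t, ht, ht'⟩ := h₂
    obtain ⟨u, hu, hu'⟩ := exists_reduced_node false s t hs ht
    exact ⟨u, hu, by rw [hu', hs', ht', ← oneLine_combinePerm]; rfl⟩

theorem toList_lt (t : SepTree) : ∀ x ∈ t.toList, x < t.toList.length := by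
  rw [← oneLine_toPerm, length_oneLine]
  intro x hx
  simp only [oneLine, List.mem_ofFn] at hx
  obtain ⟨i, rfl⟩ := hx
  exact (t.toPerm i).isLt

end SepTree

/-- `x < y` if `c = true`, and `y < x` otherwise. -/
def Compares (c : Bool) (x y : ℕ) : Prop := if c then x < y else y < x

theorem Compares.eq {c d : Bool} {x y : ℕ} (h : Compares c x y) (h' : Compares d x y) :
    c = d := by
  cases c <;> cases d <;> simp [Compares] at * <;> omega

theorem getD_combineList_left (c : Bool) (l m : List ℕ) {i : ℕ} (hi : i < l.length) :
    (combineList c l m).getD i 0 = l.getD i 0 + if c then 0 else m.length := by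
  cases c <;> simp [combineList, List.getElem?_append, hi]

theorem Compares.combineList {c e : Bool} {l m : List ℕ} {i j : ℕ} (hi : i < l.length)
    (hj : j < l.length) (h : Compares e (l.getD i 0) (l.getD j 0)) :
    Compares e ((combineList c l m).getD i 0) ((combineList c l m).getD j 0) := by
  rw [getD_combineList_left c l m hi, getD_combineList_left c l m hj]
  cases e <;> simp only [Compares] at * <;> simpa using h

theorem combineList_injective {c : Bool} {l l' m m' : List ℕ} (hl : l.length = l'.length)
    (h : combineList c l m = combineList c l' m') : l = l' ∧ m = m' := by
  have hm : m.length = m'.length := by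
    have := congrArg List.length h
    simp only [length_combineList] at this
    omega
  have hinj (k : ℕ) : Function.Injective (List.map (· + k)) :=
    List.map_injective_iff.2 (add_left_injective k)
  cases c
  · obtain ⟨h₁, h₂⟩ := List.append_inj h (by simpa using hl)
    exact ⟨hinj _ (by rw [h₁, hm]), h₂⟩
  · obtain ⟨h₁, h₂⟩ := List.append_inj h hl
    exact ⟨h₁, hinj _ (by rw [h₂, hl])⟩

namespace SepTree

theorem compares_node (c : Bool) (s t : SepTree) (i j : ℕ) (hi : i < s.size)
    (hj : s.size ≤ j) (hj' : j < s.size + t.size) :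
    Compares c ((node c s t).toList.getD i 0) ((node c s t).toList.getD j 0) := by
  rw [toList]
  have h₁ := s.toList_lt
  have h₂ := t.toList_lt
  rw [← length_toList] at hi hj hj'
  rw [← length_toList] at hj'
  have h₃ : j - s.toList.length < t.toList.length := by omega
  have h₄ := h₁ _ (List.getElem_mem hi)
  have h₅ := h₂ _ (List.getElem_mem h₃)
  cases c
  · simp [Compares, combineList, List.getElem?_append, hi, hj.not_gt, h₃]
    omega
  · simp [Compares, combineList, List.getElem?_append, hi, hj.not_gt, h₃]
    omega

theorem compares_root {t : SepTree} {c : Bool} (h : t.root = some c) :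
    Compares c (t.toList.getD 0 0) (t.toList.getD (t.size - 1) 0) := by
  cases t with
  | leaf => simp [root] at h
  | node d l r =>
    obtain rfl : d = c := by simpa [root] using h
    have := l.size_pos
    have := r.size_pos
    exact compares_node d l r _ _ (by omega) (by simp only [size]; omega)
      (by simp only [size]; omega)

theorem root_of_one_lt_size {t : SepTree} (h : 1 < t.size) : ∃ c, t.root = some c := by
  cases t with
  | leaf => simp [size] at h
  | node c l r => exact ⟨c, rfl⟩

theorem size_left_le {c : Bool} {l r l' r' : SepTree} (hl : l'.root ≠ some c)
    (h : (node c l r).toList = (node c l' r').toList) : l'.size ≤ l.size := by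
  by_contra! hlt
  have := l.size_pos
  obtain ⟨e, he⟩ := root_of_one_lt_size (t := l') (by omega)
  have h₁ : Compares e ((node c l' r').toList.getD 0 0)
      ((node c l' r').toList.getD (l'.size - 1) 0) :=
    (compares_root he).combineList (by rw [length_toList]; omega) (by rw [length_toList]; omega)
  have hsize : l.size + r.size = l'.size + r'.size := by
    simpa [length_toList, size] using congrArg List.length h
  have h₂ := compares_node c l r 0 (l'.size - 1) (by omega) (by omega) (by omega)
  rw [h] at h₂
  exact hl (he.trans (congrArg some (h₁.eq h₂)))

theorem eq_of_toList_eq {s t : SepTree} (hs : s.Reduced) (ht : t.Reduced)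
    (h : s.toList = t.toList) : s = t := by
  have hsize : s.size = t.size := by simpa [length_toList] using congrArg List.length h
  induction s generalizing t with
  | leaf =>
    cases t with
    | leaf => rfl
    | node d l' r' =>
      have := l'.size_pos
      have := r'.size_pos
      simp only [size] at hsize
      omega
  | node c l r hl hr =>
    cases t with
    | leaf =>
      have := l.size_pos
      have := r.size_pos
      simp only [size] at hsize
      omega
    | node d l' r' =>
      obtain rfl : c = d := by
        have h₁ := compares_root (t := node c l r) rfl
        have h₂ := compares_root (t := node d l' r') rfl
        rw [h, hsize] at h₁
        exact h₁.eq h₂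
      have hll : l.size = l'.size :=
        le_antisymm (size_left_le hs.1 h.symm) (size_left_le ht.1 h)
      obtain ⟨h₁, h₂⟩ := combineList_injective (by simpa only [length_toList] using hll) h
      rw [hl hs.2.1 ht.2.1 h₁ hll, hr hs.2.2 ht.2.2 h₂
        (by simpa [length_toList] using congrArg List.length h₂)]

/-- All trees of depth at most `d`. -/
noncomputable def ofDepth : ℕ → Finset SepTree
  | 0 => ∅
  | d + 1 => by
    classical
    exact insert leaf ((Finset.univ ×ˢ ofDepth d ×ˢ ofDepth d).image
      fun x => node x.1 x.2.1 x.2.2)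

theorem mem_ofDepth {t : SepTree} {d : ℕ} (h : t.size ≤ d) : t ∈ ofDepth d := by
  induction t generalizing d with
  | leaf =>
    cases d with
    | zero => simp [size] at h
    | succ d => simp [ofDepth]
  | node c l r hl hr =>
    have := l.size_pos
    have := r.size_pos
    simp only [size] at h
    obtain ⟨d, rfl⟩ : ∃ k, d = k + 1 := ⟨d - 1, by omega⟩
    have := @hl d (by omega)
    have := @hr d (by omega)
    simp [ofDepth, *]

open scoped Classical in
/-- The reduced trees with `n` leaves. -/
noncomputable def reducedOfSize (n : ℕ) : Finset SepTree :=
  (ofDepth n).filter fun t => t.Reduced ∧ t.size = n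

theorem mem_reducedOfSize {n : ℕ} {t : SepTree} :
    t ∈ reducedOfSize n ↔ t.Reduced ∧ t.size = n := by
  simp only [reducedOfSize, Finset.mem_filter, and_iff_right_iff_imp]
  exact fun h => mem_ofDepth h.2.le

open scoped Classical in
theorem sum_isSepPerm_eq_sum_reducedOfSize {n : ℕ} (F : ∀ {m : ℕ}, Perm (Fin m) → ℕ) :
    (∑ π : Perm (Fin n), if IsSepPerm π then F π else 0) =
      ∑ t ∈ reducedOfSize n, F t.toPerm := by
  rw [← Finset.sum_filter]
  have hex (π : Perm (Fin n)) (hπ : π ∈ Finset.univ.filter fun π : Perm (Fin n) => IsSepPerm π) :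
      ∃ t : SepTree, t.Reduced ∧ t.toList = oneLine π :=
    exists_reduced_of_isSepPerm (Finset.mem_filter.1 hπ).2
  choose i hi hil using hex
  have hsize (π hπ) : (i π hπ).size = n := by rw [← length_toList, hil, length_oneLine]
  refine Finset.sum_bij i (fun π hπ => mem_reducedOfSize.2 ⟨hi π hπ, hsize π hπ⟩) ?_ ?_ ?_
  · intro π hπ ρ hρ h
    apply oneLine_injective
    rw [← hil π hπ, ← hil ρ hρ, h]
  · intro t ht
    obtain ⟨hred, rfl⟩ := mem_reducedOfSize.1 ht
    refine ⟨t.toPerm, by simpa using t.isSepPerm_toPerm, ?_⟩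
    exact eq_of_toList_eq (hi _ _) hred (by rw [hil, oneLine_toPerm])
  · intro π hπ
    have h₁ := hil π hπ
    have h₂ := hsize π hπ
    generalize i π hπ = t at h₁ h₂
    subst h₂
    rw [← oneLine_toPerm] at h₁
    rw [oneLine_injective h₁]

end SepTree

/-- The laws of a pattern on an arbitrary type: `D true x y` says that `y` is above and to the
right of `x`, and `D false x y` that `y` is below and to the right of `x`. -/
structure IsPattern {X : Type*} (D : Bool → X → X → Prop) : Prop where
  total : ∀ x y, x ≠ y → ∃ c, D c x y ∨ D c y x
  unique : ∀ c d x y, D c x y → D d x y → c = d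
  asymm : ∀ c d x y, D c x y → ¬ D d y x

/-- All elements of `A` are related by `D c` to all elements of `B`. -/
def Precedes {X : Type*} (D : Bool → X → X → Prop) (c : Bool) (A B : Finset X) : Prop :=
  ∀ x ∈ A, ∀ y ∈ B, D c x y

/-- The pattern given by a permutation. -/
def permRel {n : ℕ} (π : Perm (Fin n)) (c : Bool) (i j : Fin n) : Prop :=
  i < j ∧ if c then π i < π j else π j < π i

theorem isPattern_permRel {n : ℕ} (π : Perm (Fin n)) : IsPattern (permRel π) where
  total x y h := by
    have h' := π.injective.ne h
    rcases lt_or_gt_of_ne h with h | h <;> rcases lt_or_gt_of_ne h' with h' | h' <;>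
      simp [permRel, *]
  unique c d x y h h' := by
    cases c <;> cases d <;> simp [permRel] at * <;> omega
  asymm c d x y h h' := lt_asymm h.1 h'.1

theorem IsPattern.comap {X Y : Type*} {D : Bool → Y → Y → Prop} (h : IsPattern D)
    {e : X → Y} (he : Function.Injective e) : IsPattern fun c x y => D c (e x) (e y) where
  total _ _ hxy := h.total _ _ (he.ne hxy)
  unique c d _ _ := h.unique c d _ _
  asymm c d _ _ := h.asymm c d _ _

/-- The pattern on a disjoint union in which the left summand precedes the right one. -/
def sumRel {Y Z : Type*} (c : Bool) (D : Bool → Y → Y → Prop) (E : Bool → Z → Z → Prop)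
    (d : Bool) : Y ⊕ Z → Y ⊕ Z → Prop
  | .inl u, .inl v => D d u v
  | .inl _, .inr _ => d = c
  | .inr _, .inl _ => False
  | .inr u, .inr v => E d u v

theorem permRel_combinePerm (c d : Bool) {m n : ℕ} (σ : Perm (Fin m)) (τ : Perm (Fin n))
    (x y : Fin m ⊕ Fin n) :
    permRel (combinePerm c σ τ) d (finSumFinEquiv x) (finSumFinEquiv y) ↔
      sumRel c (permRel σ) (permRel τ) d x y := by
  cases c <;> cases d <;> rcases x with x | x <;> rcases y with y | y <;>
    simp [permRel, combinePerm, directSum, skewSum, sumRel, Fin.lt_def, -Fin.val_fin_lt] <;> omega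

/-- Pattern-preserving partial maps with domain `A`. -/
abbrev PatternHom {X Y : Type*} (D : Bool → X → X → Prop) (A : Finset X)
    (E : Bool → Y → Y → Prop) : Type _ :=
  {f : X → Option Y // (∀ x, (f x).isSome ↔ x ∈ A) ∧
    ∀ c x y u v, f x = some u → f y = some v → D c x y → E c u v}

theorem card_patternHom_congr {X Y Z : Type*} (D : Bool → X → X → Prop) (A : Finset X)
    {E : Bool → Y → Y → Prop} {F : Bool → Z → Z → Prop} (e : Y ≃ Z)
    (he : ∀ c x y, F c (e x) (e y) ↔ E c x y) :
    Nat.card (PatternHom D A E) = Nat.card (PatternHom D A F) := by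
  refine Nat.card_congr (((Equiv.refl X).arrowCongr (Equiv.optionCongr e)).subtypeEquiv ?_)
  intro f
  refine and_congr (by simp) ?_
  simp only [Equiv.arrowCongr_apply, Equiv.coe_refl, Function.comp_apply, Equiv.refl_symm, id,
    Equiv.optionCongr_apply, Option.map_eq_some_iff]
  constructor
  · rintro h c x y _ _ ⟨u, hu, rfl⟩ ⟨v, hv, rfl⟩ hxy
    exact (he c u v).2 (h c x y u v hu hv hxy)
  · intro h c x y u v hu hv hxy
    exact (he c u v).1 (h c x y _ _ ⟨u, hu, rfl⟩ ⟨v, hv, rfl⟩ hxy)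

theorem IsPattern.rel_of_sumRel {X Y Z : Type*} {D : Bool → X → X → Prop} (hD : IsPattern D)
    {c : Bool} {E : Bool → Y → Y → Prop} {F : Bool → Z → Z → Prop} {x y : X} {u : Y} {v : Z}
    (hne : x ≠ y) (h₁ : ∀ d, D d x y → sumRel c E F d (.inl u) (.inr v))
    (h₂ : ∀ d, D d y x → sumRel c E F d (.inr v) (.inl u)) : D c x y := by
  obtain ⟨d, hd | hd⟩ := hD.total x y hne
  · obtain rfl : d = c := h₁ d hd
    exact hd
  · exact (h₂ d hd).elim

open scoped Classical in
theorem card_patternHom_sumRel {X Y Z : Type*} [Finite X] [Finite Y] [Finite Z]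
    {D : Bool → X → X → Prop} (hD : IsPattern D) (A : Finset X) (c : Bool)
    (E : Bool → Y → Y → Prop) (F : Bool → Z → Z → Prop) :
    Nat.card (PatternHom D A (sumRel c E F)) =
      ∑ B ∈ A.powerset with Precedes D c B (A \ B),
        Nat.card (PatternHom D B E) * Nat.card (PatternHom D (A \ B) F) := by
  set S := A.powerset.filter fun B => Precedes D c B (A \ B)
  have hmem (B : S) : B.1 ⊆ A ∧ Precedes D c B.1 (A \ B.1) :=
    ⟨Finset.mem_powerset.1 (Finset.mem_filter.1 B.2).1, (Finset.mem_filter.1 B.2).2⟩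
  let glue (p : Σ B : S, PatternHom D B.1 E × PatternHom D (A \ B.1) F) (x : X) :
      Option (Y ⊕ Z) := ((p.2.1.1 x).map Sum.inl).or ((p.2.2.1 x).map Sum.inr)
  have hdisj (p : Σ B : S, PatternHom D B.1 E × PatternHom D (A \ B.1) F) (x : X) :
      p.2.1.1 x = none ∨ p.2.2.1 x = none := by
    rw [← Option.not_isSome_iff_eq_none, ← Option.not_isSome_iff_eq_none, p.2.1.2.1, p.2.2.2.1,
      Finset.mem_sdiff]
    tauto
  have glue_inl (p x u) : glue p x = some (.inl u) ↔ p.2.1.1 x = some u := by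
    simp [glue]
  have glue_inr (p x v) : glue p x = some (.inr v) ↔ p.2.2.1 x = some v := by
    rcases hdisj p x with h | h <;> simp [glue, h]
  have glue_mem (p : Σ B : S, PatternHom D B.1 E × PatternHom D (A \ B.1) F) :
      (∀ x, (glue p x).isSome ↔ x ∈ A) ∧ ∀ d x y u v, glue p x = some u → glue p y = some v →
        D d x y → sumRel c E F d u v := by
    obtain ⟨B, g, h⟩ := p
    refine ⟨fun x => ?_, ?_⟩
    · have h₃ := @(hmem B).1 x
      simp only [glue, Option.isSome_or, Option.isSome_map, Bool.or_eq_true, g.2.1, h.2.1,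
        Finset.mem_sdiff]
      tauto
    · rintro d x y (u | u) (v | v) hu hv hd
      · exact g.2.2 d x y u v ((glue_inl _ _ _).1 hu) ((glue_inl _ _ _).1 hv) hd
      · have hx := (g.2.1 x).1 (Option.isSome_iff_exists.2 ⟨_, (glue_inl _ _ _).1 hu⟩)
        have hy := (h.2.1 y).1 (Option.isSome_iff_exists.2 ⟨_, (glue_inr _ _ _).1 hv⟩)
        exact hD.unique _ _ _ _ hd ((hmem B).2 x hx y hy)
      · have hy := (g.2.1 y).1 (Option.isSome_iff_exists.2 ⟨_, (glue_inl _ _ _).1 hv⟩)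
        have hx := (h.2.1 x).1 (Option.isSome_iff_exists.2 ⟨_, (glue_inr _ _ _).1 hu⟩)
        exact hD.asymm _ _ _ _ hd ((hmem B).2 y hy x hx)
      · exact h.2.2 d x y u v ((glue_inr _ _ _).1 hu) ((glue_inr _ _ _).1 hv) hd
  let G : (Σ B : S, PatternHom D B.1 E × PatternHom D (A \ B.1) F) →
      PatternHom D A (sumRel c E F) := fun p => ⟨glue p, glue_mem p⟩
  have hG : Function.Bijective G := by
    constructor
    · rintro p q hpq
      have hpq' (x : X) : glue p x = glue q x := congrFun (congrArg Subtype.val hpq) x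
      have hl (x : X) : p.2.1.1 x = q.2.1.1 x := by
        ext u
        rw [← glue_inl, ← glue_inl, hpq']
      have hr (x : X) : p.2.2.1 x = q.2.2.1 x := by
        ext u
        rw [← glue_inr, ← glue_inr, hpq']
      obtain ⟨B, g, h⟩ := p
      obtain ⟨B', g', h'⟩ := q
      obtain rfl : B = B' := by
        ext x
        rw [← g.2.1, ← g'.2.1, hl x]
      obtain rfl : g = g' := Subtype.ext (funext hl)
      obtain rfl : h = h' := Subtype.ext (funext hr)
      rfl
    · rintro ⟨f, hf₁, hf₂⟩
      let B : Finset X := A.filter fun x => ∃ u, f x = some (.inl u)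
      have hB (x : X) : x ∈ B ↔ ∃ u, f x = some (.inl u) := by
        simp only [B, Finset.mem_filter, and_iff_right_iff_imp, ← hf₁]
        rintro ⟨u, hu⟩
        simp [hu]
      have hB' (x : X) : x ∈ A \ B ↔ ∃ v, f x = some (.inr v) := by
        rw [Finset.mem_sdiff, hB, ← hf₁, Option.isSome_iff_exists]
        constructor
        · rintro ⟨⟨u | v, h⟩, h'⟩
          · exact (h' ⟨u, h⟩).elim
          · exact ⟨v, h⟩
        · rintro ⟨v, h⟩
          simp [h]
      have hBS : B ∈ S := by
        refine Finset.mem_filter.2 ⟨by simp [B], fun x hx y hy => ?_⟩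
        obtain ⟨u, hu⟩ := (hB x).1 hx
        obtain ⟨v, hv⟩ := (hB' y).1 hy
        refine hD.rel_of_sumRel (c := c) (E := E) (F := F) ?_
          (fun d => hf₂ d x y _ _ hu hv) (fun d => hf₂ d y x _ _ hv hu)
        rintro rfl
        simp [hu] at hv
      have hleft (x : X) (u : Y) :
          (f x).bind Sum.getLeft? = some u ↔ f x = some (.inl u) := by
        simp [Option.bind_eq_some_iff, Sum.getLeft?_eq_some_iff]
      have hright (x : X) (v : Z) :
          (f x).bind Sum.getRight? = some v ↔ f x = some (.inr v) := by
        simp [Option.bind_eq_some_iff, Sum.getRight?_eq_some_iff]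
      refine ⟨⟨⟨B, hBS⟩, ⟨fun x => (f x).bind Sum.getLeft?, ?_, ?_⟩,
        ⟨fun x => (f x).bind Sum.getRight?, ?_, ?_⟩⟩, Subtype.ext (funext fun x => ?_)⟩
      · intro x
        simp only [Option.isSome_iff_exists, hleft, hB]
      · intro d x y u v hu hv
        exact hf₂ d x y _ _ ((hleft _ _).1 hu) ((hleft _ _).1 hv)
      · intro x
        simp only [Option.isSome_iff_exists, hright, hB']
      · intro d x y u v hu hv
        exact hf₂ d x y _ _ ((hright _ _).1 hu) ((hright _ _).1 hv)
      · ext (u | v)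
        · exact (glue_inl _ _ _).trans (hleft _ _)
        · exact (glue_inr _ _ _).trans (hright _ _)
  rw [← Nat.card_congr (Equiv.ofBijective G hG), Nat.card_sigma]
  simp only [Nat.card_prod]
  exact Finset.sum_coe_sort S fun B =>
    Nat.card (PatternHom D B E) * Nat.card (PatternHom D (A \ B) F)

theorem card_patternHom_fin_one {X : Type*} {D : Bool → X → X → Prop} (hD : IsPattern D)
    (A : Finset X) : Nat.card (PatternHom D A (permRel (1 : Perm (Fin 1)))) =
      if A.card ≤ 1 then 1 else 0 := by
  classical
  have hrel (c u v) : ¬ permRel (1 : Perm (Fin 1)) c u v := fun h => by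
    rw [Subsingleton.elim u v] at h
    exact lt_irrefl _ h.1
  split_ifs with hA
  · rw [Nat.card_eq_one_iff_unique]
    refine ⟨⟨fun f g => Subtype.ext (funext fun x => ?_)⟩, ⟨⟨fun x => if x ∈ A then some 0 else
      none, fun x => by by_cases hx : x ∈ A <;> simp [hx], ?_⟩⟩⟩
    · have h₁ := f.2.1 x
      have h₂ := g.2.1 x
      cases hf : f.1 x <;> cases hg : g.1 x <;> simp_all
      exact Subsingleton.elim _ _
    · intro c x y u v hu hv hd
      have hx : x ∈ A := by by_contra hx; simp [hx] at hu
      have hy : y ∈ A := by by_contra hy; simp [hy] at hv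
      obtain rfl := Finset.card_le_one.1 hA x hx y hy
      exact (hD.asymm _ _ _ _ hd hd).elim
  · obtain ⟨x, hx, y, hy, hxy⟩ := Finset.one_lt_card.1 (not_le.1 hA)
    rw [Nat.card_eq_zero]
    refine Or.inl ⟨fun f => ?_⟩
    obtain ⟨u, hu⟩ := Option.isSome_iff_exists.1 ((f.2.1 x).2 hx)
    obtain ⟨v, hv⟩ := Option.isSome_iff_exists.1 ((f.2.1 y).2 hy)
    obtain ⟨c, hc | hc⟩ := hD.total x y hxy
    · exact hrel _ _ _ (f.2.2 c x y u v hu hv hc)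
    · exact hrel _ _ _ (f.2.2 c y x v u hv hu hc)

theorem occursAt_iff {k n : ℕ} (σ : Perm (Fin k)) (π : Perm (Fin n)) (f : Fin k → Fin n) :
    occursAt σ π f ↔ ∀ c i j, permRel σ c i j → permRel π c (f i) (f j) := by
  constructor
  · rintro ⟨hf, h⟩ c i j ⟨hij, hc⟩
    refine ⟨hf hij, ?_⟩
    cases c
    · simpa [← h] using hc
    · simpa [← h] using hc
  · intro h
    refine ⟨fun i j hij => ?_, fun i j => ?_⟩
    · rcases lt_or_gt_of_ne (σ.injective.ne hij.ne) with h' | h'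
      · exact (h true i j ⟨hij, by simpa using h'⟩).1
      · exact (h false i j ⟨hij, by simpa using h'⟩).1
    · have key (i j) (hij : σ i < σ j) : π (f i) < π (f j) := by
        rcases lt_trichotomy i j with h' | rfl | h'
        · simpa using (h true i j ⟨h', by simpa using hij⟩).2
        · exact (lt_irrefl _ hij).elim
        · simpa using (h false j i ⟨h', by simpa using hij⟩).2
      refine ⟨key i j, fun hij => ?_⟩
      rcases lt_trichotomy (σ i) (σ j) with h' | h' | h'
      · exact h'
      · rw [σ.injective h'] at hij
        exact (lt_irrefl _ hij).elim
      · exact (lt_asymm hij (key j i h')).elim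

theorem occCount_eq_card_patternHom {X : Type*} [Fintype X] {k n : ℕ} (σ : Perm (Fin k))
    (π : Perm (Fin n)) (e : X ≃ Fin k) :
    occCount σ π =
      Nat.card (PatternHom (fun c x y => permRel σ c (e x) (e y)) Finset.univ (permRel π)) := by
  refine Nat.card_eq_of_bijective (fun f => ⟨fun x => some (f.1 (e x)), by simp, ?_⟩) ⟨?_, ?_⟩
  · intro c x y u v hu hv h
    simp only [Option.some.injEq] at hu hv
    subst hu hv
    exact (occursAt_iff σ π f.1).1 f.2 _ _ _ h
  · intro f g h
    refine Subtype.ext (funext fun i => ?_)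
    simpa using congrFun (congrArg Subtype.val h) (e.symm i)
  · intro g
    have hg (x : X) : ∃ u, g.1 x = some u :=
      Option.isSome_iff_exists.1 ((g.2.1 x).2 (Finset.mem_univ x))
    choose f hf using hg
    refine ⟨⟨fun i => f (e.symm i), (occursAt_iff σ π _).2 fun c i j h => ?_⟩, ?_⟩
    · exact g.2.2 c _ _ _ _ (hf _) (hf _) (by simpa using h)
    · exact Subtype.ext (funext fun x => by simp [hf])

open scoped Classical in
/-- The number of occurrences of the pattern `D` restricted to `A` in the separable permutation
of a tree. -/
noncomputable def SepTree.occ {X : Type*} (D : Bool → X → X → Prop) : SepTree → Finset X → ℕ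
  | leaf, A => if A.card ≤ 1 then 1 else 0
  | node c l r, A => ∑ B ∈ A.powerset with Precedes D c B (A \ B), occ D l B * occ D r (A \ B)

theorem SepTree.occ_eq_card_patternHom {X : Type*} [Finite X] {D : Bool → X → X → Prop}
    (hD : IsPattern D) (t : SepTree) (A : Finset X) :
    t.occ D A = Nat.card (PatternHom D A (permRel t.toPerm)) := by
  classical
  induction t generalizing A with
  | leaf => rw [occ]; exact (card_patternHom_fin_one hD A).symm
  | node c l r hl hr =>
    have h := card_patternHom_congr D A (finSumFinEquiv (m := l.size) (n := r.size))
      fun d => permRel_combinePerm c d l.toPerm r.toPerm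
    rw [card_patternHom_sumRel hD] at h
    simp only [occ, hl, hr]
    exact h

theorem SepTree.occ_congr {X : Type*} {D D' : Bool → X → X → Prop} (t : SepTree) {A : Finset X}
    (h : ∀ c, ∀ x ∈ A, ∀ y ∈ A, D c x y ↔ D' c x y) : t.occ D A = t.occ D' A := by
  classical
  induction t generalizing A with
  | leaf => rfl
  | node c l r hl hr =>
    rw [occ, occ]
    refine Finset.sum_congr (Finset.filter_congr fun B hB => ?_) fun B hB => ?_
    · have hB := Finset.mem_powerset.1 hB
      exact forall₂_congr fun _ hx => forall₂_congr fun _ hy =>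
        h c _ (hB hx) _ (Finset.sdiff_subset hy)
    · have hB := Finset.mem_powerset.1 (Finset.mem_filter.1 hB).1
      rw [hl fun d _ hx _ hy => h d _ (hB hx) _ (hB hy),
        hr fun d _ hx _ hy => h d _ (Finset.sdiff_subset hx) _ (Finset.sdiff_subset hy)]

theorem sepPop_eq_sum_occ {X : Type*} [Fintype X] {k : ℕ} (σ : Perm (Fin k)) (e : X ≃ Fin k)
    (n : ℕ) : sepPop σ n = ∑ t ∈ SepTree.reducedOfSize n,
      t.occ (fun c x y => permRel σ c (e x) (e y)) Finset.univ := by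
  rw [sepPop, SepTree.sum_isSepPerm_eq_sum_reducedOfSize (fun π => occCount σ π)]
  refine Finset.sum_congr rfl fun t _ => ?_
  rw [SepTree.occ_eq_card_patternHom ((isPattern_permRel σ).comap e.injective),
    occCount_eq_card_patternHom σ t.toPerm e]

section Series

variable {X : Type*}

namespace SepTree

/-- The generating series, by size, of the number of occurrences of `D` restricted to `A` in
separable permutations. -/
noncomputable def series (D : Bool → X → X → Prop) (A : Finset X) : PowerSeries ℤ :=
  PowerSeries.mk fun n => ∑ t ∈ reducedOfSize n, (t.occ D A : ℤ)

open scoped Classical in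
/-- The part of `series` that comes from trees with root label `o`. -/
noncomputable def rootSeries (D : Bool → X → X → Prop) (o : Option Bool) (A : Finset X) :
    PowerSeries ℤ :=
  PowerSeries.mk fun n => ∑ t ∈ reducedOfSize n with t.root = o, (t.occ D A : ℤ)

/-- The part of `series` that comes from trees whose root label is not `c`. -/
noncomputable def offSeries (D : Bool → X → X → Prop) (c : Bool) (A : Finset X) :
    PowerSeries ℤ :=
  series D A - rootSeries D (some c) A

theorem coeff_offSeries (D : Bool → X → X → Prop) [DecidableEq (Option Bool)] (c : Bool)
    (A : Finset X) (n : ℕ) : PowerSeries.coeff n (offSeries D c A) =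
      ∑ t ∈ reducedOfSize n with t.root ≠ some c, (t.occ D A : ℤ) := by
  rw [offSeries, map_sub, series, rootSeries, PowerSeries.coeff_mk, PowerSeries.coeff_mk,
    sub_eq_iff_eq_add', ← Finset.sum_filter_add_sum_filter_not _ (fun t => t.root = some c)]
  congr!

theorem series_eq_add (D : Bool → X → X → Prop) (A : Finset X) :
    series D A = rootSeries D none A + rootSeries D (some true) A +
      rootSeries D (some false) A := by
  ext n
  simp only [series, rootSeries, map_add, PowerSeries.coeff_mk, Finset.sum_filter,
    ← Finset.sum_add_distrib]
  refine Finset.sum_congr rfl fun t _ => ?_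
  rcases t.root with _ | _ | _ <;> simp

theorem reducedOfSize_zero : reducedOfSize 0 = ∅ := by
  ext t
  have := t.size_pos
  simp [mem_reducedOfSize, this.ne']

theorem constantCoeff_series (D : Bool → X → X → Prop) (A : Finset X) :
    PowerSeries.constantCoeff (series D A) = 0 := by
  rw [← PowerSeries.coeff_zero_eq_constantCoeff_apply, series, PowerSeries.coeff_mk,
    reducedOfSize_zero, Finset.sum_empty]

theorem constantCoeff_offSeries (D : Bool → X → X → Prop) (c : Bool) (A : Finset X) :
    PowerSeries.constantCoeff (offSeries D c A) = 0 := by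
  classical
  rw [← PowerSeries.coeff_zero_eq_constantCoeff_apply, coeff_offSeries,
    reducedOfSize_zero, Finset.filter_empty, Finset.sum_empty]

theorem series_congr {D D' : Bool → X → X → Prop} {A : Finset X}
    (h : ∀ c, ∀ x ∈ A, ∀ y ∈ A, D c x y ↔ D' c x y) : series D A = series D' A := by
  simp only [series, occ_congr _ h]

theorem offSeries_congr {D D' : Bool → X → X → Prop} {A : Finset X} (c : Bool)
    (h : ∀ c, ∀ x ∈ A, ∀ y ∈ A, D c x y ↔ D' c x y) : offSeries D c A = offSeries D' c A := by
  simp only [offSeries, rootSeries, series_congr h, occ_congr _ h]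

theorem rootSeries_none (D : Bool → X → X → Prop) {A : Finset X} (hA : 1 < A.card) :
    rootSeries D none A = 0 := by
  ext n
  rw [rootSeries, PowerSeries.coeff_mk]
  refine Finset.sum_eq_zero fun t ht => ?_
  cases t with
  | leaf => simp [occ, hA]
  | node c l r => exact absurd (Finset.mem_filter.1 ht).2 (by simp [root])

/-- The ways of cutting `A` into a part followed by another one, with `D c` relating them. -/
noncomputable def cuts [DecidableEq X] (D : Bool → X → X → Prop) (c : Bool) (A : Finset X) :
    Finset (Finset X) := by
  classical
  exact A.powerset.filter fun B => Precedes D c B (A \ B)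

theorem mem_cuts [DecidableEq X] {D : Bool → X → X → Prop} {c : Bool} {A B : Finset X} :
    B ∈ cuts D c A ↔ B ⊆ A ∧ Precedes D c B (A \ B) := by
  simp [cuts]

theorem sum_reducedOfSize_root (c : Bool) (n : ℕ) (F : SepTree → ℤ)
    [DecidableEq (Option Bool)] :
    ∑ t ∈ reducedOfSize n with t.root = some c, F t =
      ∑ p ∈ Finset.HasAntidiagonal.antidiagonal n, ∑ l ∈ reducedOfSize p.1 with l.root ≠ some c,
        ∑ r ∈ reducedOfSize p.2, F (node c l r) := by
  simp_rw [Finset.sum_sigma']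
  symm
  refine Finset.sum_bij (fun x _ => node c x.2.1 x.2.2) ?_ ?_ ?_ ?_
  · rintro ⟨p, l, r⟩ h
    simp only [Finset.mem_sigma, Finset.HasAntidiagonal.mem_antidiagonal, Finset.mem_filter,
      mem_reducedOfSize] at h
    exact Finset.mem_filter.2 ⟨mem_reducedOfSize.2 ⟨⟨h.2.1.2, h.2.1.1.1, h.2.2.1⟩,
      by rw [size, h.2.1.1.2, h.2.2.2, h.1]⟩, rfl⟩
  · rintro ⟨⟨i, j⟩, l, r⟩ h ⟨⟨i', j'⟩, l', r'⟩ h' heq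
    simp only [Finset.mem_sigma, Finset.mem_filter, mem_reducedOfSize] at h h'
    obtain ⟨-, rfl, rfl⟩ := node.inj heq
    obtain rfl : i = i' := h.2.1.1.2.symm.trans h'.2.1.1.2
    obtain rfl : j = j' := h.2.2.2.symm.trans h'.2.2.2
    rfl
  · intro t ht
    obtain ⟨hmem, hroot⟩ := Finset.mem_filter.1 ht
    cases t with
    | leaf => simp [root] at hroot
    | node d l r =>
      obtain rfl : d = c := Option.some.inj hroot
      obtain ⟨⟨h₁, h₂, h₃⟩, h₄⟩ := mem_reducedOfSize.1 hmem
      exact ⟨⟨(l.size, r.size), l, r⟩, by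
        simp [mem_reducedOfSize, h₁, h₂, h₃, ← h₄, size], rfl⟩
  · intro x _
    rfl

theorem rootSeries_some [DecidableEq X] (D : Bool → X → X → Prop) (c : Bool) (A : Finset X) :
    rootSeries D (some c) A = ∑ B ∈ cuts D c A, offSeries D c B * series D (A \ B) := by
  classical
  ext n
  rw [rootSeries, PowerSeries.coeff_mk, map_sum, sum_reducedOfSize_root]
  simp only [PowerSeries.coeff_mul, coeff_offSeries]
  refine Eq.trans ?_ Finset.sum_comm
  refine Finset.sum_congr rfl fun p _ => ?_
  simp only [series, PowerSeries.coeff_mk, Finset.sum_mul_sum]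
  refine Eq.trans ?_ Finset.sum_comm
  refine Finset.sum_congr rfl fun l _ => ?_
  refine Eq.trans ?_ Finset.sum_comm
  refine Finset.sum_congr rfl fun r _ => ?_
  rw [occ, Nat.cast_sum]
  simp only [Nat.cast_mul, cuts]
  congr!

theorem series_eq_offSeries_add [DecidableEq X] (D : Bool → X → X → Prop) (c : Bool)
    (A : Finset X) : series D A =
      offSeries D c A + ∑ B ∈ cuts D c A, offSeries D c B * series D (A \ B) := by
  rw [← rootSeries_some, offSeries, sub_add_cancel]

theorem one_sub_offSeries_mul (D : Bool → X → X → Prop) (c : Bool) :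
    (1 - offSeries D c ∅) * (1 + series D ∅) = 1 := by
  classical
  have h := series_eq_offSeries_add D c ∅
  have hcuts : cuts D c ∅ = {∅} := by
    ext B
    simp +contextual [mem_cuts, Precedes]
  rw [hcuts, Finset.sum_singleton, Finset.sdiff_self] at h
  linear_combination h

theorem disjoint_of_precedes {D : Bool → X → X → Prop} (hD : IsPattern D)
    {U A : Finset X} {c : Bool} (h : Precedes D c U A) :
    Disjoint U A :=
  Finset.disjoint_left.2 fun x hx hx' => hD.asymm _ _ _ _ (h x hx x hx') (h x hx x hx')

/-- `U` cannot be cut into two nonempty parts, the second one above and to the right of the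
first one. -/
def Indecomposable [DecidableEq X] (D : Bool → X → X → Prop) (U : Finset X) : Prop :=
  ∀ B ∈ cuts D true U, B = ∅ ∨ B = U

variable [DecidableEq X] {D : Bool → X → X → Prop} {U A : Finset X}

theorem Indecomposable.disjoint_or_subset (hU : Indecomposable D U) {B : Finset X}
    (hB : B ∈ cuts D true (U ∪ A)) : Disjoint U B ∨ U ⊆ B := by
  obtain ⟨-, h⟩ := mem_cuts.1 hB
  refine (hU (U ∩ B) (mem_cuts.2 ⟨Finset.inter_subset_left, fun x hx y hy => ?_⟩)).imp
    Finset.disjoint_iff_inter_eq_empty.2 Finset.inter_eq_left.1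
  refine h x (Finset.mem_inter.1 hx).2 y ?_
  simp only [Finset.mem_sdiff, Finset.mem_inter, Finset.mem_union] at hy ⊢
  tauto

theorem cuts_union_of_precedes (hD : IsPattern D) (hU : Indecomposable D U)
    (hU₀ : U.Nonempty) (h : Precedes D true U A) :
    cuts D true (U ∪ A) = insert ∅ ((cuts D true A).image (U ∪ ·)) := by
  ext B
  simp only [Finset.mem_insert, Finset.mem_image]
  constructor
  · intro hB
    obtain ⟨hBs, hBp⟩ := mem_cuts.1 hB
    refine (hU.disjoint_or_subset hB).imp (fun hdis => ?_) fun hsub => ⟨B \ U, ?_, ?_⟩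
    · refine Finset.eq_empty_of_forall_notMem fun x hx => ?_
      obtain ⟨u, hu⟩ := hU₀
      have hxA : x ∈ A := (Finset.mem_union.1 (hBs hx)).resolve_left
        (Finset.disjoint_right.1 hdis hx)
      exact hD.asymm _ _ _ _ (h u hu x hxA) (hBp x hx u (Finset.mem_sdiff.2
        ⟨Finset.mem_union_left _ hu, Finset.disjoint_left.1 hdis hu⟩))
    · refine mem_cuts.2 ⟨fun x hx => ?_, fun x hx y hy => ?_⟩
      · have := hBs (Finset.mem_sdiff.1 hx).1
        simp only [Finset.mem_sdiff, Finset.mem_union] at hx this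
        tauto
      · by_cases hyU : y ∈ U
        · have hyy := h y hyU y (Finset.mem_sdiff.1 hy).1
          exact (hD.asymm _ _ _ _ hyy hyy).elim
        · refine hBp x (Finset.mem_sdiff.1 hx).1 y ?_
          simp only [Finset.mem_sdiff, Finset.mem_union] at hy ⊢
          tauto
    · exact Finset.union_sdiff_of_subset hsub
  · rintro (rfl | ⟨B, hB, rfl⟩)
    · exact mem_cuts.2 ⟨Finset.empty_subset _, fun x hx => by simp at hx⟩
    · obtain ⟨hBs, hBp⟩ := mem_cuts.1 hB
      refine mem_cuts.2 ⟨Finset.union_subset_union_right hBs, fun x hx y hy => ?_⟩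
      have hy' : y ∈ A \ B := by
        simp only [Finset.mem_sdiff, Finset.mem_union] at hy ⊢
        tauto
      rcases Finset.mem_union.1 hx with hx | hx
      · exact h x hx y (Finset.mem_sdiff.1 hy').1
      · exact hBp x hx y hy'

theorem cuts_union_of_precedes' (hD : IsPattern D) (hU : Indecomposable D U)
    (hU₀ : U.Nonempty) (h : Precedes D true A U) :
    cuts D true (U ∪ A) = insert (U ∪ A) (cuts D true A) := by
  ext B
  rw [Finset.mem_insert]
  constructor
  · intro hB
    obtain ⟨hBs, hBp⟩ := mem_cuts.1 hB
    refine (hU.disjoint_or_subset hB).symm.imp (fun hsub => ?_) fun hdis => ?_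
    · refine hBs.antisymm fun y hy => ?_
      by_contra hyB
      obtain ⟨u, hu⟩ := hU₀
      have hyA : y ∈ A := (Finset.mem_union.1 hy).resolve_left fun hyU => hyB (hsub hyU)
      exact hD.asymm _ _ _ _ (h y hyA u hu) (hBp u (hsub hu) y (Finset.mem_sdiff.2 ⟨hy, hyB⟩))
    · refine mem_cuts.2 ⟨fun x hx => (Finset.mem_union.1 (hBs hx)).resolve_left
        (Finset.disjoint_right.1 hdis hx), fun x hx y hy => hBp x hx y ?_⟩
      exact Finset.sdiff_subset_sdiff Finset.subset_union_right le_rfl hy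
  · rintro (rfl | hB)
    · exact mem_cuts.2 ⟨le_rfl, fun x _ y hy => by simp at hy⟩
    · obtain ⟨hBs, hBp⟩ := mem_cuts.1 hB
      refine mem_cuts.2 ⟨hBs.trans Finset.subset_union_right, fun x hx y hy => ?_⟩
      obtain ⟨hy, hyB⟩ := Finset.mem_sdiff.1 hy
      rcases Finset.mem_union.1 hy with hyU | hyA
      · exact h x (hBs hx) y hyU
      · exact hBp x hx y (Finset.mem_sdiff.2 ⟨hyA, hyB⟩)

theorem cuts_false_union (hD : IsPattern D) (hU₀ : U.Nonempty) (hA₀ : A.Nonempty)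
    (h : Precedes D true U A ∨ Precedes D true A U) :
    cuts D false (U ∪ A) = {∅, U ∪ A} := by
  have hrel (x) (hx : x ∈ U) (y) (hy : y ∈ A) : D true x y ∨ D true y x :=
    h.imp (fun h => h x hx y hy) fun h => h y hy x hx
  ext B
  simp only [Finset.mem_insert, Finset.mem_singleton]
  constructor
  · intro hB
    obtain ⟨hBs, hBp⟩ := mem_cuts.1 hB
    have hiff (x) (hx : x ∈ U) (y) (hy : y ∈ A) : x ∈ B ↔ y ∈ B := by
      have hx' : x ∈ U ∪ A := Finset.mem_union_left _ hx
      have hy' : y ∈ U ∪ A := Finset.mem_union_right _ hy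
      by_contra hne
      have hcross : D false x y ∨ D false y x := by
        by_cases hxB : x ∈ B
        · exact Or.inl (hBp x hxB y (Finset.mem_sdiff.2 ⟨hy', by tauto⟩))
        · exact Or.inr (hBp y (by tauto) x (Finset.mem_sdiff.2 ⟨hx', hxB⟩))
      rcases hcross with h₁ | h₁ <;> rcases hrel x hx y hy with h₂ | h₂
      · exact absurd (hD.unique _ _ _ _ h₁ h₂) (by simp)
      · exact hD.asymm _ _ _ _ h₁ h₂
      · exact hD.asymm _ _ _ _ h₁ h₂
      · exact absurd (hD.unique _ _ _ _ h₁ h₂) (by simp)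
    obtain ⟨u, hu⟩ := hU₀
    obtain ⟨a, ha⟩ := hA₀
    have hall (x) (hx : x ∈ U ∪ A) : x ∈ B ↔ u ∈ B := by
      rcases Finset.mem_union.1 hx with hx | hx
      · rw [hiff x hx a ha, hiff u hu a ha]
      · rw [hiff u hu x hx]
    by_cases huB : u ∈ B
    · exact Or.inr (hBs.antisymm fun x hx => (hall x hx).2 huB)
    · exact Or.inl (Finset.eq_empty_of_forall_notMem fun x hx => huB ((hall x (hBs hx)).1 hx))
  · rintro (rfl | rfl)
    · exact mem_cuts.2 ⟨Finset.empty_subset _, fun x hx => by simp at hx⟩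
    · exact mem_cuts.2 ⟨le_rfl, fun x _ y hy => by simp at hy⟩

theorem series_union_of_precedes (hD : IsPattern D) (hU : Indecomposable D U)
    (hU₀ : U.Nonempty) (h : Precedes D true U A) :
    series D (U ∪ A) = offSeries D true (U ∪ A) + offSeries D true ∅ * series D (U ∪ A) +
      ∑ B ∈ cuts D true A, offSeries D true (U ∪ B) * series D (A \ B) := by
  have hdis := disjoint_of_precedes hD h
  have hsub (B : Finset X) (hB : B ∈ cuts D true A) : Disjoint U B :=
    hdis.mono_right (mem_cuts.1 hB).1
  rw [add_assoc]
  conv_lhs => rw [series_eq_offSeries_add D true]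
  rw [cuts_union_of_precedes hD hU hU₀ h, Finset.sum_insert, Finset.sum_image,
    Finset.sdiff_empty]
  · congr 2
    refine Finset.sum_congr rfl fun B _ => ?_
    have hsdiff : (U ∪ A) \ (U ∪ B) = A \ B := by
      ext x
      have hx : x ∈ U → x ∉ A := fun h => Finset.disjoint_left.1 hdis h
      simp only [Finset.mem_sdiff, Finset.mem_union]
      tauto
    rw [hsdiff]
  · intro B hB B' hB' heq
    have := congrArg (· \ U) heq
    simpa [Finset.union_sdiff_cancel_left, hsub B hB, hsub B' hB'] using this
  · simp only [Finset.mem_image, Finset.union_eq_empty, not_exists, not_and]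
    intro B _ h
    exact (hU₀.ne_empty h).elim

theorem series_union_of_precedes' (hD : IsPattern D) (hU : Indecomposable D U)
    (hU₀ : U.Nonempty) (h : Precedes D true A U) :
    series D (U ∪ A) = offSeries D true (U ∪ A) + offSeries D true (U ∪ A) * series D ∅ +
      ∑ B ∈ cuts D true A, offSeries D true B * series D (U ∪ A \ B) := by
  have hdis := disjoint_of_precedes hD h
  rw [add_assoc, series_eq_offSeries_add D true (U ∪ A), cuts_union_of_precedes' hD hU hU₀ h,
    Finset.sum_insert, Finset.sdiff_self]
  · congr 2
    refine Finset.sum_congr rfl fun B hB => ?_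
    rw [Finset.union_sdiff_distrib,
      sdiff_eq_left.2 (hdis.symm.mono_right (mem_cuts.1 hB).1)]
  · intro hmem
    obtain ⟨u, hu⟩ := hU₀
    exact Finset.disjoint_right.1 hdis hu
      ((mem_cuts.1 hmem).1 (Finset.mem_union_left _ hu))

theorem mul_offSeries_union (hD : IsPattern D) (hU₀ : U.Nonempty) (hA₀ : A.Nonempty)
    (h : Precedes D true U A ∨ Precedes D true A U) :
    (1 + series D ∅) * offSeries D true (U ∪ A) =
      (offSeries D false ∅ + series D ∅) * series D (U ∪ A) := by
  have hdis : Disjoint U A := h.elim (disjoint_of_precedes hD)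
    fun h => (disjoint_of_precedes hD h).symm
  have hcard : 1 < (U ∪ A).card := by
    rw [Finset.card_union_of_disjoint hdis]
    have := hU₀.card_pos
    have := hA₀.card_pos
    omega
  have h₁ := series_eq_add D (U ∪ A)
  have h₂ := rootSeries_some D false (U ∪ A)
  have hne : (∅ : Finset X) ≠ U ∪ A := by
    rintro h
    simp [← h] at hcard
  rw [cuts_false_union hD hU₀ hA₀ h, Finset.sum_pair hne, Finset.sdiff_empty,
    Finset.sdiff_self] at h₂
  rw [rootSeries_none D hcard] at h₁
  simp only [offSeries] at h₂ ⊢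
  linear_combination h₂ + (1 + series D ∅) * h₁

/-- The parts of `V` that can be cut off at its lower left. -/
abbrev Cut (D : Bool → X → X → Prop) (V : Finset X) : Type _ :=
  {C : Finset X // C ∈ cuts D true V}

/-- The matrix whose entries are the values of `f` at the intervals between two cuts of `V`. -/
def cutMatrix {R : Type*} [Zero R] (D : Bool → X → X → Prop) (V : Finset X)
    (f : Finset X → R) : Matrix (Cut D V) (Cut D V) R :=
  Matrix.of fun i j => if i.1 ⊆ j.1 then f (j.1 \ i.1) else 0

theorem sum_cuts_sdiff {R : Type*} [AddCommMonoid R] {V : Finset X} {i j : Cut D V}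
    (hij : i.1 ⊆ j.1) (F : Finset X → Finset X → R) :
    ∑ B ∈ cuts D true (j.1 \ i.1), F B ((j.1 \ i.1) \ B) =
      ∑ m : Cut D V with i.1 ⊆ m.1 ∧ m.1 ⊆ j.1, F (m.1 \ i.1) (j.1 \ m.1) := by
  obtain ⟨i, hi⟩ := i
  obtain ⟨j, hj⟩ := j
  obtain ⟨hi₁, hi₂⟩ := mem_cuts.1 hi
  obtain ⟨hj₁, hj₂⟩ := mem_cuts.1 hj
  dsimp only at hij ⊢
  refine Finset.sum_bij' (fun B hB => ⟨i ∪ B, mem_cuts.2 ⟨?_, ?_⟩⟩) (fun m _ => m.1 \ i)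
    ?_ ?_ ?_ ?_ ?_
  · exact Finset.union_subset hi₁
      ((mem_cuts.1 hB).1.trans (Finset.sdiff_subset.trans hj₁))
  · intro x hx y hy
    obtain ⟨hB₁, hB₂⟩ := mem_cuts.1 hB
    simp only [Finset.mem_union, Finset.mem_sdiff, not_or] at hx hy
    rcases hx with hx | hx
    · exact hi₂ x hx y (Finset.mem_sdiff.2 ⟨hy.1, hy.2.1⟩)
    · by_cases hyj : y ∈ j
      · exact hB₂ x hx y (by simp [hyj, hy])
      · exact hj₂ x (Finset.mem_sdiff.1 (hB₁ hx)).1 y (Finset.mem_sdiff.2 ⟨hy.1, hyj⟩)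
  · intro B hB
    simp only [Finset.mem_filter, Finset.mem_univ, true_and]
    exact ⟨Finset.subset_union_left,
      Finset.union_subset hij ((mem_cuts.1 hB).1.trans Finset.sdiff_subset)⟩
  · intro m hm
    simp only [Finset.mem_filter, Finset.mem_univ, true_and] at hm
    refine mem_cuts.2 ⟨Finset.sdiff_subset_sdiff hm.2 le_rfl, fun x hx y hy => ?_⟩
    refine (mem_cuts.1 m.2).2 x (Finset.mem_sdiff.1 hx).1 y ?_
    simp only [Finset.mem_sdiff] at hy ⊢
    exact ⟨hj₁ hy.1.1, by tauto⟩
  · intro B hB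
    have hdis : Disjoint i B := Finset.disjoint_left.2 fun x hx hxB =>
      (Finset.mem_sdiff.1 ((mem_cuts.1 hB).1 hxB)).2 hx
    exact Finset.union_sdiff_cancel_left hdis
  · intro m hm
    simp only [Finset.mem_filter, Finset.mem_univ, true_and] at hm
    exact Subtype.ext (Finset.union_sdiff_of_subset hm.1)
  · intro B hB
    have hdis : Disjoint i B := Finset.disjoint_left.2 fun x hx hxB =>
      (Finset.mem_sdiff.1 ((mem_cuts.1 hB).1 hxB)).2 hx
    congr 1
    · exact (Finset.union_sdiff_cancel_left hdis).symm
    · ext x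
      simp only [Finset.mem_sdiff, Finset.mem_union]
      tauto

theorem cutMatrix_mul_apply {R : Type*} [NonUnitalNonAssocSemiring R] {V : Finset X}
    (f g : Finset X → R) (i j : Cut D V) :
    (cutMatrix D V f * cutMatrix D V g) i j = if i.1 ⊆ j.1 then
      ∑ B ∈ cuts D true (j.1 \ i.1), f B * g ((j.1 \ i.1) \ B) else 0 := by
  rw [Matrix.mul_apply]
  split_ifs with hij
  · rw [sum_cuts_sdiff hij fun B C => f B * g C, Finset.sum_filter]
    refine Finset.sum_congr rfl fun m _ => ?_
    simp only [cutMatrix, Matrix.of_apply]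
    split_ifs <;> simp_all
  · refine Finset.sum_eq_zero fun m _ => ?_
    simp only [cutMatrix, Matrix.of_apply]
    by_cases h₁ : i.1 ⊆ m.1
    · rw [if_neg fun h₂ : m.1 ⊆ j.1 => hij (h₁.trans h₂), mul_zero]
    · rw [if_neg h₁, zero_mul]

theorem sdiff_subset_of_cut {V : Finset X} (i j : Cut D V) : j.1 \ i.1 ⊆ V :=
  Finset.sdiff_subset.trans (mem_cuts.1 j.2).1

theorem one_sub_cutMatrix_mul (D : Bool → X → X → Prop) (V : Finset X) :
    (1 - cutMatrix D V (offSeries D true)) * (1 + cutMatrix D V (series D)) = 1 := by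
  have h : cutMatrix D V (series D) = cutMatrix D V (offSeries D true) +
      cutMatrix D V (offSeries D true) * cutMatrix D V (series D) := by
    ext1 i j
    rw [Matrix.add_apply, cutMatrix_mul_apply]
    simp only [cutMatrix, Matrix.of_apply]
    split_ifs
    · exact series_eq_offSeries_add D true _
    · simp
  have h' := sub_eq_zero.2 h
  rw [← sub_eq_zero, ← h']
  noncomm_ring

theorem smul_cutMatrix_offSeries_union {V : Finset X} {D₀ : Bool → X → X → Prop}
    (hD : IsPattern D) (hU₀ : U.Nonempty) (h : Precedes D true U V ∨ Precedes D true V U) :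
    (1 + series D ∅) • cutMatrix D₀ V (fun A => offSeries D true (U ∪ A)) =
      (offSeries D false ∅ + series D ∅) • cutMatrix D₀ V (fun A => series D (U ∪ A)) +
        ((1 + series D ∅) * offSeries D true U -
          (offSeries D false ∅ + series D ∅) * series D U) • 1 := by
  ext1 i j
  simp only [Matrix.add_apply, Matrix.smul_apply, cutMatrix, Matrix.of_apply, smul_eq_mul]
  rcases eq_or_ne i j with rfl | hij
  · simp
  rw [Matrix.one_apply_ne hij]
  split_ifs with hsub
  · have hA₀ : (j.1 \ i.1).Nonempty :=
      Finset.sdiff_nonempty.2 fun h => hij (Subtype.ext (hsub.antisymm h))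
    have hA := sdiff_subset_of_cut i j
    rw [mul_zero, add_zero, mul_offSeries_union hD hU₀ hA₀]
    exact h.imp (fun h x hx y hy => h x hx y (hA hy)) fun h x hx y hy => h x (hA hx) y hy
  · simp

theorem cutMatrix_series_union {V : Finset X} (hD : IsPattern D) (hU : Indecomposable D U)
    (hU₀ : U.Nonempty) (h : Precedes D true U V) :
    cutMatrix D V (fun A => series D (U ∪ A)) =
      ((1 + series D ∅) • cutMatrix D V (fun A => offSeries D true (U ∪ A))) *
        (1 + cutMatrix D V (series D)) := by
  set L := cutMatrix D V (fun A => series D (U ∪ A)) with hL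
  set N := cutMatrix D V (fun A => offSeries D true (U ∪ A)) with hN
  have key : L = N + offSeries D true ∅ • L + N * cutMatrix D V (series D) := by
    ext1 i j
    rw [Matrix.add_apply, Matrix.add_apply, Matrix.smul_apply, hN, cutMatrix_mul_apply]
    simp only [hL, cutMatrix, Matrix.of_apply, smul_eq_mul]
    split_ifs
    · exact series_union_of_precedes hD hU hU₀
        fun x hx y hy => h x hx y (sdiff_subset_of_cut i j hy)
    · simp
  have key' : (1 - offSeries D true ∅) • L = N * (1 + cutMatrix D V (series D)) := by
    rw [sub_smul, one_smul, sub_eq_iff_eq_add, mul_add, mul_one]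
    conv_lhs => rw [key]
    abel
  rw [smul_mul_assoc, ← key', smul_smul, mul_comm, one_sub_offSeries_mul, one_smul]

theorem cutMatrix_series_union' {V : Finset X} {D₀ : Bool → X → X → Prop}
    (hD₀ : ∀ c, ∀ x ∈ V, ∀ y ∈ V, D₀ c x y ↔ D c x y)
    (hD : IsPattern D) (hU : Indecomposable D U)
    (hU₀ : U.Nonempty) (h : Precedes D true V U) :
    cutMatrix D₀ V (fun A => series D (U ∪ A)) = (1 + cutMatrix D₀ V (series D₀)) *
      ((1 + series D ∅) • cutMatrix D₀ V (fun A => offSeries D true (U ∪ A))) := by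
  set L := cutMatrix D₀ V (fun A => series D (U ∪ A)) with hL
  set N := cutMatrix D₀ V (fun A => offSeries D true (U ∪ A)) with hN
  set S := cutMatrix D₀ V (offSeries D₀ true) with hS
  have hmono {A : Finset X} (hA : A ⊆ V) : ∀ c, ∀ x ∈ A, ∀ y ∈ A, D₀ c x y ↔ D c x y :=
    fun c x hx y hy => hD₀ c x (hA hx) y (hA hy)
  have hcuts {A : Finset X} (hA : A ⊆ V) : cuts D true A = cuts D₀ true A := by
    ext B
    rw [mem_cuts, mem_cuts]
    exact and_congr_right fun hB => forall₂_congr fun x hx => forall₂_congr fun y hy =>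
      (hD₀ true x (hA (hB hx)) y (hA (Finset.sdiff_subset hy))).symm
  have key : L = (1 + series D ∅) • N + S * L := by
    ext1 i j
    have hA := sdiff_subset_of_cut i j
    rw [Matrix.add_apply, Matrix.smul_apply, hL, cutMatrix_mul_apply]
    simp only [hN, cutMatrix, Matrix.of_apply, smul_eq_mul]
    split_ifs
    · rw [series_union_of_precedes' hD hU hU₀ fun x hx y hy => h x (hA hx) y hy, hcuts hA]
      congr 1
      · ring
      · refine Finset.sum_congr rfl fun B hB => ?_
        rw [offSeries_congr true (hmono ((mem_cuts.1 hB).1.trans hA))]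
    · simp
  have hinv := mul_eq_one_comm.1 (one_sub_cutMatrix_mul D₀ V)
  calc L = ((1 + cutMatrix D₀ V (series D₀)) * (1 - S)) * L := by rw [hinv, one_mul]
    _ = (1 + cutMatrix D₀ V (series D₀)) * (L - S * L) := by
      rw [mul_assoc, sub_mul, one_mul]
    _ = _ := by rw [sub_eq_of_eq_add key]

theorem matrix_eq_of_mul_eq {ι : Type*} [Fintype ι] [DecidableEq ι]
    {E L R : Matrix ι ι (PowerSeries ℤ)} {q s : PowerSeries ℤ}
    (hq : PowerSeries.constantCoeff q = 0) (hL : L = (q • L + s • 1) * E)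
    (hR : R = E * (q • R + s • 1)) : L = R := by
  set u : Matrix ι ι (PowerSeries ℤ) := 1 - q • E with hu
  have hL' : L * u = s • E := by
    rw [hu, mul_sub, mul_one, sub_eq_iff_eq_add]
    conv_lhs => rw [hL]
    simp [add_mul, add_comm]
  have hR' : u * R = s • E := by
    rw [hu, sub_mul, one_mul, sub_eq_iff_eq_add]
    conv_lhs => rw [hR]
    simp [mul_add, add_comm]
  have hcomm : u * E = E * u := by simp [hu, sub_mul, mul_sub]
  have hunit : IsUnit u := by
    rw [Matrix.isUnit_iff_isUnit_det, PowerSeries.isUnit_iff_constantCoeff, RingHom.map_det]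
    have : (PowerSeries.constantCoeff (R := ℤ)).mapMatrix u = 1 := by
      ext i j
      simp [hu, hq, Matrix.one_apply, apply_ite]
    rw [this, Matrix.det_one]
    exact isUnit_one
  refine hunit.mul_left_cancel (hunit.mul_right_cancel ?_)
  rw [mul_assoc, hL', hR', mul_smul_comm, smul_mul_assoc, hcomm]

/-- Moving an indecomposable part of a pattern from the lower left to the upper right of the
rest does not change the generating series. -/
theorem series_union_eq_of_precedes {V : Finset X} {D' : Bool → X → X → Prop}
    (hD : IsPattern D) (hD' : IsPattern D') (hU : Indecomposable D U) (hU₀ : U.Nonempty)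
    (hUU : ∀ c, ∀ x ∈ U, ∀ y ∈ U, D c x y ↔ D' c x y)
    (hVV : ∀ c, ∀ x ∈ V, ∀ y ∈ V, D c x y ↔ D' c x y)
    (hUV : Precedes D true U V) (hVU : Precedes D' true V U) :
    series D (U ∪ V) = series D' (U ∪ V) := by
  have hempty : ∀ c, ∀ x ∈ (∅ : Finset X), ∀ y ∈ (∅ : Finset X), D c x y ↔ D' c x y := by
    simp
  have hU' : Indecomposable D' U := fun B hB => hU B <| by
    rw [mem_cuts] at hB ⊢
    exact ⟨hB.1, fun x hx y hy =>
      (hUU true x (hB.1 hx) y (Finset.sdiff_subset hy)).2 (hB.2 x hx y hy)⟩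
  have hL := cutMatrix_series_union hD hU hU₀ hUV
  have hR := cutMatrix_series_union' hVV hD' hU' hU₀ hVU
  rw [smul_cutMatrix_offSeries_union hD hU₀ (Or.inl hUV)] at hL
  rw [smul_cutMatrix_offSeries_union hD' hU₀ (Or.inr hVU), ← series_congr hempty,
    ← series_congr hUU, ← offSeries_congr _ hempty, ← offSeries_congr _ hUU] at hR
  have hLR := matrix_eq_of_mul_eq
    (by rw [map_add, constantCoeff_offSeries, constantCoeff_series, add_zero]) hL hR
  have h := congrFun (congrFun hLR
    ⟨∅, mem_cuts.2 ⟨Finset.empty_subset _, fun x hx => by simp at hx⟩⟩)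
    ⟨V, mem_cuts.2 ⟨le_rfl, fun x _ y hy => by simp at hy⟩⟩
  simpa only [cutMatrix, Matrix.of_apply, Finset.empty_subset, if_true, Finset.sdiff_empty] using h

end SepTree

end Series

/-- An initial part of a permutation whose values are also initial gives a sum decomposition. -/
theorem sumDecomposable_of_precedes {n : ℕ} (σ : Perm (Fin n)) {B : Finset (Fin n)}
    (hB₀ : B.Nonempty) (hB₁ : B ≠ Finset.univ)
    (h : ∀ x ∈ B, ∀ y ∉ B, x < y ∧ σ x < σ y) : SumDecomposable σ := by
  have hlt (ρ : Perm (Fin n)) (hρ : ∀ x ∈ B, ∀ y ∉ B, ρ x < ρ y) (x) (hx : x ∈ B) :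
      (ρ x : ℕ) < B.card := by
    have hsub : (Finset.Iic (ρ x)).map ρ.symm.toEmbedding ⊆ B := by
      intro z hz
      simp only [Finset.mem_map_equiv, Equiv.symm_symm, Finset.mem_Iic] at hz
      by_contra hzB
      exact absurd (hρ x hx z hzB) (not_lt.2 hz)
    have := Finset.card_le_card hsub
    rw [Finset.card_map, Fin.card_Iic] at this
    exact this
  have hmem : Finset.univ.filter (fun x : Fin n => (x : ℕ) < B.card) = B := by
    symm
    refine Finset.eq_of_subset_of_card_le
      (fun x hx => by simpa using hlt 1 (fun x hx y hy => (h x hx y hy).1) x hx) ?_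
    rw [Fin.card_filter_val_lt]
    exact min_le_right _ _
  have hmaps (x : Fin n) (hx : (x : ℕ) < B.card) : (σ x : ℕ) < B.card :=
    hlt σ (fun x hx y hy => (h x hx y hy).2) x (by rw [← hmem]; simpa using hx)
  have hcard : B.card < n := by
    simpa using Finset.card_lt_card (Finset.ssubset_univ_iff.2 hB₁)
  have hpos := hB₀.card_pos
  generalize B.card = m at hmaps hcard hpos
  obtain ⟨k, rfl⟩ := Nat.exists_eq_add_of_le hcard.le
  have hk : 0 < k := by lia
  let ρ : Perm (Fin m ⊕ Fin k) := finSumFinEquiv.trans (σ.trans finSumFinEquiv.symm)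
  have hρ : Set.MapsTo ρ (Set.range Sum.inl) (Set.range Sum.inl) := by
    rintro _ ⟨i, rfl⟩
    have hi := hmaps (finSumFinEquiv (Sum.inl i : Fin m ⊕ Fin k)) (by simp)
    refine ⟨⟨_, hi⟩, finSumFinEquiv.injective ?_⟩
    ext
    simp [ρ]
  obtain ⟨⟨σ₁, σ₂⟩, hσ⟩ := Equiv.Perm.mem_sumCongrHom_range_of_perm_mapsTo_inl hρ
  refine ⟨m, k, rfl, σ₁, σ₂, hpos, hk, ?_⟩
  have hσ' : Equiv.sumCongr σ₁ σ₂ = ρ := hσ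
  rw [directSum, hσ']
  ext x
  simp [ρ]

theorem permRel_directSum (c : Bool) {m n : ℕ} (σ : Perm (Fin m)) (τ : Perm (Fin n))
    (x y : Fin m ⊕ Fin n) :
    permRel (directSum σ τ) c (finSumFinEquiv x) (finSumFinEquiv y) ↔
      sumRel true (permRel σ) (permRel τ) c x y :=
  permRel_combinePerm true c σ τ x y

theorem sepPop_eq_coeff_series {X : Type*} [Fintype X] {k : ℕ} (σ : Perm (Fin k))
    (e : X ≃ Fin k) (n : ℕ) : (sepPop σ n : ℤ) = PowerSeries.coeff n
      (SepTree.series (fun c x y => permRel σ c (e x) (e y)) Finset.univ) := by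
  rw [sepPop_eq_sum_occ σ e, SepTree.series, PowerSeries.coeff_mk, Nat.cast_sum]

/-- If `σ` is sum indecomposable, then `σ ⊕ τ` and `τ ⊕ σ` are equipopular in the
separable permutations. -/
theorem sumIndecomposable_swap_equipopular {a b : ℕ} (σ : Perm (Fin a)) (τ : Perm (Fin b))
    (hσ : SumIndecomposable σ) (n : ℕ) :
    sepPop (directSum σ τ) n = sepPop (directSum τ σ) n := by
  classical
  let e : Fin a ⊕ Fin b ≃ Fin (a + b) := finSumFinEquiv
  let e' : Fin a ⊕ Fin b ≃ Fin (b + a) := (Equiv.sumComm _ _).trans finSumFinEquiv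
  have hD := (isPattern_permRel (directSum σ τ)).comap e.injective
  have hD' := (isPattern_permRel (directSum τ σ)).comap e'.injective
  have h (c) (x y) : permRel (directSum σ τ) c (e x) (e y) ↔
      sumRel true (permRel σ) (permRel τ) c x y := permRel_directSum c σ τ x y
  have h' (c) (x y) : permRel (directSum τ σ) c (e' x) (e' y) ↔
      sumRel true (permRel τ) (permRel σ) c x.swap y.swap :=
    permRel_directSum c τ σ x.swap y.swap
  refine Nat.cast_injective (R := ℤ) ?_
  rw [sepPop_eq_coeff_series _ e, sepPop_eq_coeff_series _ e']
  congr 1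
  let U : Finset (Fin a ⊕ Fin b) := Finset.univ.map Function.Embedding.inl
  let V : Finset (Fin a ⊕ Fin b) := Finset.univ.map Function.Embedding.inr
  have hUV : (Finset.univ : Finset (Fin a ⊕ Fin b)) = U ∪ V := by
    ext (x | x) <;> simp [U, V]
  have hVV : ∀ c, ∀ x ∈ V, ∀ y ∈ V, permRel (directSum σ τ) c (e x) (e y) ↔
      permRel (directSum τ σ) c (e' x) (e' y) := by
    intro c x hx y hy
    obtain ⟨x, -, rfl⟩ := Finset.mem_map.1 hx
    obtain ⟨y, -, rfl⟩ := Finset.mem_map.1 hy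
    rw [h, h']
    rfl
  rcases U.eq_empty_or_nonempty with hU₀ | hU₀
  · rw [hUV, hU₀, Finset.empty_union]
    exact SepTree.series_congr hVV
  rw [hUV]
  refine SepTree.series_union_eq_of_precedes hD hD' ?_ hU₀ ?_ hVV ?_ ?_
  · intro B hB
    obtain ⟨hBU, hB⟩ := SepTree.mem_cuts.1 hB
    by_contra! hne
    have hmem (x : Fin a ⊕ Fin b) (hx : x ∈ B) : ∃ i, Sum.inl i = x := by
      simpa [U] using hBU hx
    refine hσ (sumDecomposable_of_precedes σ
      (B := Finset.univ.filter fun i => Sum.inl i ∈ B) ?_ ?_ ?_)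
    · obtain ⟨x, hx⟩ := hne.1
      obtain ⟨i, rfl⟩ := hmem x hx
      exact ⟨i, by simpa using hx⟩
    · intro huniv
      refine hne.2 (hBU.antisymm fun x hx => ?_)
      obtain ⟨i, -, rfl⟩ := Finset.mem_map.1 hx
      simpa using huniv.ge (Finset.mem_univ i)
    · intro x hx y hy
      have := (h _ _ _).1 (hB (Sum.inl x) (by simpa using hx) (Sum.inl y)
        (Finset.mem_sdiff.2 ⟨by simp [U], by simpa using hy⟩))
      simpa [sumRel, permRel] using this
  · intro c x hx y hy
    obtain ⟨x, -, rfl⟩ := Finset.mem_map.1 hx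
    obtain ⟨y, -, rfl⟩ := Finset.mem_map.1 hy
    rw [h, h']
    rfl
  · intro x hx y hy
    obtain ⟨x, -, rfl⟩ := Finset.mem_map.1 hx
    obtain ⟨y, -, rfl⟩ := Finset.mem_map.1 hy
    exact (h _ _ _).2 rfl
  · intro x hx y hy
    obtain ⟨x, -, rfl⟩ := Finset.mem_map.1 hx
    obtain ⟨y, -, rfl⟩ := Finset.mem_map.1 hy
    exact (h' _ _ _).2 rfl
end

section
/- There exists a family of formal power series F_m (m ≥ 0), independent of π, such that for every sum indecomposable separable permutation π, the popularity generating function of I(m) ⊕ π in the separable permutations satisfies P_{I(m)⊕π}(t) = F_m(t) · P_π(t), where I(m) is the increasing permutation of length m. -/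
open Equiv

/-- Popularity generating function of the pattern `σ` in the separable permutations. -/
noncomputable def Pgf {k : ℕ} (σ : Perm (Fin k)) : PowerSeries ℚ :=
  PowerSeries.mk fun n => (sepPop σ n : ℚ)

lemma directSum_castAdd {m n : ℕ} (σ : Perm (Fin m)) (τ : Perm (Fin n)) (i : Fin m) :
    directSum σ τ (Fin.castAdd n i) = Fin.castAdd n (σ i) := by
  simp [directSum]

lemma directSum_natAdd {m n : ℕ} (σ : Perm (Fin m)) (τ : Perm (Fin n)) (i : Fin n) :
    directSum σ τ (Fin.natAdd m i) = Fin.natAdd m (τ i) := by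
  simp [directSum]

lemma skewSum_castAdd {m n : ℕ} (σ : Perm (Fin m)) (τ : Perm (Fin n)) (i : Fin m) :
    (skewSum σ τ (Fin.castAdd n i)).val = n + σ i := by
  simp [skewSum, add_comm]

lemma skewSum_natAdd {m n : ℕ} (σ : Perm (Fin m)) (τ : Perm (Fin n)) (i : Fin n) :
    (skewSum σ τ (Fin.natAdd m i)).val = τ i := by
  simp [skewSum]

/-- Permutations of all finite lengths. -/
abbrev SizedPerm := Σ n : ℕ, Perm (Fin n)

namespace SizedPerm

/-- The value at position `i`, extended by the identity beyond the length. -/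
def val (x : SizedPerm) (i : ℕ) : ℕ := if h : i < x.1 then (x.2 ⟨i, h⟩).val else i

/-- Direct sum, without length bookkeeping in the type. -/
def dsum (x y : SizedPerm) : SizedPerm := ⟨x.1 + y.1, directSum x.2 y.2⟩

/-- The identity permutation of length `m`. -/
def ident (m : ℕ) : SizedPerm := ⟨m, 1⟩

/-- The complement, which reverses the values. -/
def compl (x : SizedPerm) : SizedPerm := ⟨x.1, x.2.trans Fin.revPerm⟩

def SumDec (x : SizedPerm) : Prop := ∃ y z : SizedPerm, 0 < y.1 ∧ 0 < z.1 ∧ x = dsum y z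

def Sep (x : SizedPerm) : Prop := IsSepPerm x.2

noncomputable def occ (x y : SizedPerm) : ℕ := occCount x.2 y.2

@[simp] lemma size_dsum (x y : SizedPerm) : (dsum x y).1 = x.1 + y.1 := rfl

@[simp] lemma size_ident (m : ℕ) : (ident m).1 = m := rfl

@[simp] lemma size_compl (x : SizedPerm) : (compl x).1 = x.1 := rfl

lemma val_of_lt (x : SizedPerm) {i : ℕ} (h : i < x.1) : val x i = x.2 ⟨i, h⟩ := dif_pos h

lemma val_of_le (x : SizedPerm) {i : ℕ} (h : x.1 ≤ i) : val x i = i := dif_neg h.not_gt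

lemma val_fin (x : SizedPerm) (i : Fin x.1) : val x i = x.2 i := by simp [val]

lemma val_lt_iff (x : SizedPerm) (i : ℕ) : val x i < x.1 ↔ i < x.1 := by
  unfold val; split_ifs with h <;> simp [h]

lemma val_injective (x : SizedPerm) : Function.Injective (val x) := by
  intro i j hij
  have hi := val_lt_iff x i
  have hj := val_lt_iff x j
  rw [hij] at hi
  by_cases h : i < x.1
  · have h' : j < x.1 := by tauto
    simp only [val, h, h', dif_pos, Fin.val_inj, EmbeddingLike.apply_eq_iff_eq, Fin.mk.injEq]
      at hij
    exact hij
  · have h' : ¬ j < x.1 := by tauto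
    simpa [val, h, h'] using hij

lemma ext_val {x y : SizedPerm} (h : x.1 = y.1) (hv : ∀ i, i < x.1 → val x i = val y i) :
    x = y := by
  obtain ⟨n, σ⟩ := x
  obtain ⟨k, τ⟩ := y
  obtain rfl : n = k := h
  congr 1
  ext i
  have := hv i i.2
  simpa [val] using this

@[simp] lemma val_ident (m i : ℕ) : val (ident m) i = i := by
  by_cases h : i < m
  · rw [val_of_lt _ (by simpa using h)]
    rfl
  · exact val_of_le _ (not_lt.1 h)

lemma val_dsum (x y : SizedPerm) (i : ℕ) :
    val (dsum x y) i = if i < x.1 then val x i else x.1 + val y (i - x.1) := by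
  by_cases h : i < x.1
  · rw [if_pos h, val_of_lt x h, val_of_lt (dsum x y) (by simp; omega)]
    exact congrArg Fin.val (directSum_castAdd x.2 y.2 ⟨i, h⟩)
  · rw [if_neg h]
    by_cases h' : i < x.1 + y.1
    · have h3 : i - x.1 < y.1 := by omega
      have e : (⟨i, h'⟩ : Fin (x.1 + y.1)) = Fin.natAdd x.1 ⟨i - x.1, h3⟩ :=
        Fin.ext (by simp; omega)
      rw [val_of_lt y h3, val_of_lt (dsum x y) h']
      exact congrArg Fin.val ((congrArg _ e).trans (directSum_natAdd x.2 y.2 ⟨i - x.1, h3⟩))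
    · rw [val_of_le y (by omega), val_of_le (dsum x y) (by simp; omega)]
      omega

lemma val_compl (x : SizedPerm) {i : ℕ} (h : i < x.1) :
    val (compl x) i = x.1 - 1 - val x i := by
  rw [val_of_lt (compl x) h, val_of_lt x h]
  change (Fin.rev (x.2 ⟨i, h⟩)).val = _
  rw [Fin.val_rev]
  omega

lemma dsum_assoc (x y z : SizedPerm) : dsum (dsum x y) z = dsum x (dsum y z) := by
  refine ext_val (by simp [add_assoc]) fun i _ => ?_
  simp only [val_dsum, size_dsum]
  have : i - (x.1 + y.1) = i - x.1 - y.1 := by omega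
  rw [this]
  split_ifs <;> omega

lemma dsum_ident (i j : ℕ) : dsum (ident i) (ident j) = ident (i + j) := by
  refine ext_val rfl fun k _ => ?_
  simp only [val_dsum, size_ident, val_ident]
  split_ifs <;> omega

lemma ident_zero_dsum (x : SizedPerm) : dsum (ident 0) x = x :=
  ext_val (by simp) fun i _ => by simp [val_dsum]

lemma dsum_ident_zero (x : SizedPerm) : dsum x (ident 0) = x := by
  refine ext_val (by simp) fun i hi => ?_
  simp only [size_dsum, size_ident] at hi
  simp only [val_dsum]
  split_ifs
  · rfl
  · omega

lemma compl_compl (x : SizedPerm) : compl (compl x) = x := by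
  refine ext_val rfl fun i hi => ?_
  simp only [size_compl] at hi
  have := (val_lt_iff x i).2 hi
  rw [val_compl _ (by simpa using hi), val_compl _ hi, size_compl]
  omega

lemma compl_skewSum (x y : SizedPerm) :
    compl ⟨x.1 + y.1, skewSum x.2 y.2⟩ = dsum (compl x) (compl y) := by
  refine ext_val rfl fun i hi => ?_
  simp only [size_compl] at hi
  rw [val_compl _ (by simpa using hi), val_dsum]
  by_cases h : i < x.1
  · have h1 : val ⟨x.1 + y.1, skewSum x.2 y.2⟩ i = y.1 + val x i := by
      rw [val_of_lt _ hi, val_of_lt _ h]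
      exact skewSum_castAdd x.2 y.2 ⟨i, h⟩
    have := (val_lt_iff x i).2 h
    rw [h1, if_pos (by simpa using h), val_compl _ h]
    simp only
    omega
  · have h3 : i - x.1 < y.1 := by omega
    have e : (⟨i, hi⟩ : Fin (x.1 + y.1)) = Fin.natAdd x.1 ⟨i - x.1, h3⟩ :=
      Fin.ext (by simp; omega)
    have h1 : val ⟨x.1 + y.1, skewSum x.2 y.2⟩ i = val y (i - x.1) := by
      rw [val_of_lt _ hi, val_of_lt _ h3]
      exact (congrArg (fun j => (skewSum x.2 y.2 j).val) e).trans
        (skewSum_natAdd x.2 y.2 ⟨i - x.1, h3⟩)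
    have := (val_lt_iff y _).2 h3
    rw [h1, if_neg (by simpa using h), size_compl, val_compl _ h3]
    simp only
    omega

lemma exists_dsum_of_lt (x : SizedPerm) {j : ℕ} (hj : j ≤ x.1)
    (h : ∀ i, i < j → val x i < j) : ∃ y z : SizedPerm, y.1 = j ∧ x = dsum y z := by
  have hinj : Function.Injective fun i : Fin j => (⟨val x i, h i i.2⟩ : Fin j) := by
    intro a b hab
    simp only [Fin.mk.injEq] at hab
    exact Fin.ext (val_injective x hab)
  have hbij := Finite.injective_iff_bijective.1 hinj
  have hge : ∀ i, j ≤ i → j ≤ val x i := by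
    intro i hi
    by_contra! hlt
    obtain ⟨k, hk⟩ := hbij.2 ⟨_, hlt⟩
    simp only [Fin.mk.injEq] at hk
    have := val_injective x hk
    omega
  have hlt : ∀ i : Fin (x.1 - j), val x (j + i) - j < x.1 - j := by
    intro i
    have := (val_lt_iff x (j + i)).2 (by omega)
    have := hge (j + i) (by omega)
    omega
  have hinj' : Function.Injective
      fun i : Fin (x.1 - j) => (⟨val x (j + i) - j, hlt i⟩ : Fin (x.1 - j)) := by
    intro a b hab
    simp only [Fin.mk.injEq] at hab
    have ha := hge (j + a) (by omega)
    have hb := hge (j + b) (by omega)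
    have := @val_injective x (j + a) (j + b) (by omega)
    exact Fin.ext (by omega)
  have hbij' := Finite.injective_iff_bijective.1 hinj'
  refine ⟨⟨j, Equiv.ofBijective _ hbij⟩, ⟨x.1 - j, Equiv.ofBijective _ hbij'⟩, rfl,
    ext_val (by simp; omega) fun i hi => ?_⟩
  rw [val_dsum]
  by_cases hij : i < j
  · simp [val, hij]
  · have h1 : i - j < x.1 - j := by omega
    have := hge i (by omega)
    have e : j + (i - j) = i := by omega
    rw [if_neg (by simpa using hij)]
    conv_rhs => rw [val]
    simp only [h1, dif_pos, Equiv.ofBijective_apply, e]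
    omega

lemma sumDec_of_lt (x : SizedPerm) {j : ℕ} (h0 : 0 < j) (hj : j < x.1)
    (h : ∀ i, i < j → val x i < j) : SumDec x := by
  obtain ⟨y, z, rfl, rfl⟩ := exists_dsum_of_lt x hj.le h
  exact ⟨y, z, h0, by simpa using hj, rfl⟩

lemma SumDec.val_zero_lt {x : SizedPerm} (h : SumDec x) : val x 0 < val x (x.1 - 1) := by
  obtain ⟨y, z, hy, hz, rfl⟩ := h
  have := (val_lt_iff y 0).2 hy
  rw [val_dsum, val_dsum, if_pos hy, if_neg (by simp; omega)]
  omega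

lemma SumDec.not_compl {x : SizedPerm} (h : SumDec x) : ¬ SumDec (compl x) := by
  intro h'
  have h1 := h.val_zero_lt
  have h2 := h'.val_zero_lt
  have hx : 0 < x.1 := by
    obtain ⟨y, z, hy, hz, rfl⟩ := h
    simp; omega
  rw [size_compl, val_compl _ hx, val_compl _ (by omega)] at h2
  omega

lemma dsum_inj_of_size {y z y' z' : SizedPerm} (h : dsum y z = dsum y' z') (hs : y.1 = y'.1) :
    y = y' ∧ z = z' := by
  have hn : y.1 + z.1 = y'.1 + z'.1 := congrArg Sigma.fst h
  have hv : ∀ i, val (dsum y z) i = val (dsum y' z') i := fun i => by rw [h]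
  simp only [val_dsum] at hv
  constructor
  · refine ext_val hs fun i hi => ?_
    simpa [hi, ← hs] using hv i
  · refine ext_val (by omega) fun i hi => ?_
    simpa [← hs] using hv (y.1 + i)

lemma size_le_of_dsum_eq {y z y' z' : SizedPerm} (h : dsum y z = dsum y' z') (hy : 0 < y.1)
    (hi : ¬ SumDec y') : y'.1 ≤ y.1 := by
  by_contra! hlt
  refine hi (sumDec_of_lt y' hy hlt fun i hi => ?_)
  have hv : val (dsum y z) i = val (dsum y' z') i := by rw [h]
  rw [val_dsum, val_dsum, if_pos hi, if_pos (hi.trans hlt)] at hv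
  rw [← hv]
  exact (val_lt_iff y i).2 hi

lemma Sep.size_pos {x : SizedPerm} (h : Sep x) : 0 < x.1 := by
  obtain ⟨n, σ⟩ := x
  change IsSepPerm σ at h
  induction h with
  | single => simp
  | dsum _ _ h1 h2 => simp only at *; omega
  | ssum _ _ h1 h2 => simp only at *; omega

lemma Sep.dsum {x y : SizedPerm} (hx : Sep x) (hy : Sep y) : Sep (dsum x y) :=
  IsSepPerm.dsum hx hy

lemma Sep.compl {x : SizedPerm} (h : Sep x) : Sep (compl x) := by
  obtain ⟨n, σ⟩ := x
  change IsSepPerm σ at h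
  induction h with
  | single =>
    have : SizedPerm.compl ⟨1, 1⟩ = ⟨1, 1⟩ := by
      refine ext_val rfl fun i _ => ?_
      have hi : i < 1 := ‹_›
      rw [val_compl ⟨1, 1⟩ hi, val_of_lt ⟨1, 1⟩ hi]
      simp
    rw [this]
    exact IsSepPerm.single
  | @dsum m n σ τ _ _ h1 h2 =>
    have := compl_skewSum (SizedPerm.compl ⟨m, σ⟩) (SizedPerm.compl ⟨n, τ⟩)
    rw [compl_compl, compl_compl] at this
    have e : SizedPerm.compl ⟨m + n, directSum σ τ⟩ = _ :=
      (congrArg SizedPerm.compl this).symm.trans (compl_compl _)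
    rw [e]
    exact IsSepPerm.ssum h1 h2
  | @ssum m n σ τ _ _ h1 h2 =>
    rw [compl_skewSum ⟨m, σ⟩ ⟨n, τ⟩]
    exact Sep.dsum h1 h2

lemma sep_compl_iff {x : SizedPerm} : Sep (compl x) ↔ Sep x :=
  ⟨fun h => compl_compl x ▸ h.compl, Sep.compl⟩

lemma Sep.trichotomy {x : SizedPerm} (h : Sep x) :
    x.1 = 1 ∨ SumDec x ∨ SumDec (SizedPerm.compl x) := by
  obtain ⟨n, σ⟩ := x
  change IsSepPerm σ at h
  cases h with
  | single => simp
  | @dsum m n σ τ h1 h2 =>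
    exact Or.inr (Or.inl ⟨⟨m, σ⟩, ⟨n, τ⟩, Sep.size_pos h1, Sep.size_pos h2, rfl⟩)
  | @ssum m n σ τ h1 h2 =>
    exact Or.inr (Or.inr ⟨SizedPerm.compl ⟨m, σ⟩, SizedPerm.compl ⟨n, τ⟩,
      Sep.size_pos (x := ⟨m, σ⟩) h1, Sep.size_pos (x := ⟨n, τ⟩) h2,
      compl_skewSum ⟨m, σ⟩ ⟨n, τ⟩⟩)

lemma not_sumDec_of_size_le_one {x : SizedPerm} (h : x.1 ≤ 1) : ¬ SumDec x := by
  rintro ⟨y, z, hy, hz, rfl⟩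
  simp at h
  omega

lemma Sep.exists_first {x : SizedPerm} (h : Sep x) (hd : SumDec x) :
    ∃ y z, (Sep y ∧ ¬ SumDec y) ∧ Sep z ∧ x = SizedPerm.dsum y z := by
  obtain ⟨n, σ⟩ := x
  change IsSepPerm σ at h
  induction h with
  | single => exact absurd hd (not_sumDec_of_size_le_one le_rfl)
  | @dsum m n σ τ h1 h2 ih1 ih2 =>
    by_cases hs : SumDec ⟨m, σ⟩
    · obtain ⟨y, z, hy, hz, e⟩ := ih1 hs
      refine ⟨y, SizedPerm.dsum z ⟨n, τ⟩, hy, hz.dsum h2, ?_⟩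
      rw [← dsum_assoc, ← e]
      rfl
    · exact ⟨⟨m, σ⟩, ⟨n, τ⟩, ⟨h1, hs⟩, h2, rfl⟩
  | @ssum m n σ τ h1 h2 =>
    refine absurd ?_ hd.not_compl
    exact ⟨SizedPerm.compl ⟨m, σ⟩, SizedPerm.compl ⟨n, τ⟩,
      Sep.size_pos (x := ⟨m, σ⟩) h1, Sep.size_pos (x := ⟨n, τ⟩) h2,
      compl_skewSum ⟨m, σ⟩ ⟨n, τ⟩⟩

lemma occ_of_size_zero {x : SizedPerm} (h : x.1 = 0) (y : SizedPerm) : occ x y = 1 := by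
  obtain ⟨n, σ⟩ := x
  obtain rfl : n = 0 := h
  refine Nat.card_eq_one_iff_exists.2
    ⟨⟨fun i => i.elim0, fun i => i.elim0, fun i => i.elim0⟩, fun f => ?_⟩
  exact Subtype.ext (funext fun i => i.elim0)

lemma occ_of_size_lt {x y : SizedPerm} (h : y.1 < x.1) : occ x y = 0 := by
  have : IsEmpty {f : Fin x.1 → Fin y.1 // occursAt x.2 y.2 f} := by
    refine ⟨fun f => ?_⟩
    have := Fintype.card_le_of_injective f.1 f.2.1.injective
    simp only [Fintype.card_fin] at this
    omega
  exact Nat.card_of_isEmpty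

lemma occ_compl (x y : SizedPerm) : occ (compl x) (compl y) = occ x y := by
  refine Nat.card_congr (Equiv.subtypeEquivRight fun f => and_congr_right fun _ => ?_)
  change (∀ i j, Fin.rev (x.2 i) < Fin.rev (x.2 j) ↔ Fin.rev (y.2 (f i)) < Fin.rev (y.2 (f j))) ↔ _
  simp only [Fin.rev_lt_rev]
  exact forall_comm

/-- Occurrences of `x` in `dsum y z` whose first `j` entries are exactly those lying in `y`. -/
def CutOcc (x y z : SizedPerm) (j : ℕ) : Type :=
  {f : Fin x.1 → Fin (dsum y z).1 // occursAt x.2 (dsum y z).2 f ∧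
    ∀ i, (f i).val < y.1 ↔ i.val < j}

lemma strictMono_addCases {a b c d : ℕ} {f : Fin a → Fin c} {g : Fin b → Fin d}
    (hf : StrictMono f) (hg : StrictMono g) :
    StrictMono (Fin.addCases (fun i => Fin.castAdd d (f i)) fun i => Fin.natAdd c (g i) :
      Fin (a + b) → Fin (c + d)) := by
  intro i j
  refine Fin.addCases (fun i => ?_) (fun i => ?_) i <;>
    refine Fin.addCases (fun j => ?_) (fun j => ?_) j <;> intro hij
  · simpa [(Fin.strictMono_castAdd _).lt_iff_lt] using
      hf (by simpa [(Fin.strictMono_castAdd _).lt_iff_lt] using hij)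
  · simp only [Fin.addCases_left, Fin.addCases_right, Fin.lt_def, Fin.val_castAdd, Fin.val_natAdd]
    omega
  · simp only [Fin.lt_def, Fin.val_castAdd, Fin.val_natAdd] at hij
    omega
  · simpa using hg (by simpa using hij)

lemma card_cutOcc_dsum (x₁ x₂ y z : SizedPerm) :
    Nat.card (CutOcc (dsum x₁ x₂) y z x₁.1) = occ x₁ y * occ x₂ z := by
  unfold occ occCount
  rw [← Nat.card_prod]
  symm
  obtain ⟨a, σ₁⟩ := x₁
  obtain ⟨b, σ₂⟩ := x₂
  obtain ⟨c, τ₁⟩ := y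
  obtain ⟨d, τ₂⟩ := z
  simp only
  let φ : {f : Fin a → Fin c // occursAt σ₁ τ₁ f} × {f : Fin b → Fin d // occursAt σ₂ τ₂ f} →
      CutOcc (dsum ⟨a, σ₁⟩ ⟨b, σ₂⟩) ⟨c, τ₁⟩ ⟨d, τ₂⟩ a := fun p =>
    ⟨(Fin.addCases (fun i => Fin.castAdd d (p.1.1 i)) fun i => Fin.natAdd c (p.2.1 i) :
      Fin (a + b) → Fin (c + d)), ⟨strictMono_addCases p.1.2.1 p.2.2.1, by
        intro i j
        change directSum σ₁ σ₂ i < directSum σ₁ σ₂ j ↔ directSum τ₁ τ₂ _ < directSum τ₁ τ₂ _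
        refine Fin.addCases (fun i => ?_) (fun i => ?_) i <;>
          refine Fin.addCases (fun j => ?_) (fun j => ?_) j
        · simpa [directSum_castAdd, (Fin.strictMono_castAdd _).lt_iff_lt] using p.1.2.2 i j
        · simp only [Fin.addCases_left, Fin.addCases_right, directSum_castAdd, directSum_natAdd,
            Fin.lt_def, Fin.val_castAdd, Fin.val_natAdd]
          omega
        · simp only [Fin.addCases_left, Fin.addCases_right, directSum_castAdd, directSum_natAdd,
            Fin.lt_def, Fin.val_castAdd, Fin.val_natAdd]
          omega
        · simpa [directSum_natAdd] using p.2.2.2 i j⟩, by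
        intro i
        change (Fin.addCases _ _ (i : Fin (a + b)) : Fin (c + d)).val < c ↔ _
        refine Fin.addCases (fun i => ?_) (fun i => ?_) i
        · simp
        · simp⟩
  refine Nat.card_congr (Equiv.ofBijective φ ⟨?_, ?_⟩)
  · rintro ⟨⟨f, hf⟩, ⟨g, hg⟩⟩ ⟨⟨f', hf'⟩, ⟨g', hg'⟩⟩ h
    have h' : ∀ i : Fin (a + b), _ = _ := congrFun (congrArg Subtype.val h)
    simp only [φ] at h'
    refine Prod.ext (Subtype.ext (funext fun i => ?_)) (Subtype.ext (funext fun i => ?_))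
    · simpa using h' (Fin.castAdd b i)
    · simpa using h' (Fin.natAdd a i)
  · rintro ⟨f, ⟨hm, ho⟩, hc⟩
    change Fin (a + b) → Fin (c + d) at f
    change ∀ i j, directSum σ₁ σ₂ i < directSum σ₁ σ₂ j ↔
      directSum τ₁ τ₂ (f i) < directSum τ₁ τ₂ (f j) at ho
    change ∀ i : Fin (a + b), (f i).val < c ↔ i.val < a at hc
    change ∀ i j : Fin (a + b), i < j → f i < f j at hm
    have h1 : ∀ i : Fin a, ∃ j, f (Fin.castAdd b i) = Fin.castAdd d j := fun i =>
      ⟨⟨f (Fin.castAdd b i), (hc _).2 (by simp)⟩, rfl⟩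
    have h2 : ∀ i : Fin b, ∃ j, f (Fin.natAdd a i) = Fin.natAdd c j := fun i => by
      have h := (hc (Fin.natAdd a i)).not.2 (by simp)
      refine ⟨⟨f (Fin.natAdd a i) - c, by omega⟩, Fin.ext ?_⟩
      simp only [Fin.val_natAdd]
      omega
    choose g hg using h1
    choose k hk using h2
    refine ⟨⟨⟨g, fun i j hij => ?_, fun i j => ?_⟩, ⟨k, fun i j hij => ?_, fun i j => ?_⟩⟩,
      Subtype.ext (funext fun i : Fin (a + b) => ?_)⟩
    · simpa [hg, (Fin.strictMono_castAdd _).lt_iff_lt] using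
        hm (Fin.castAdd b i) (Fin.castAdd b j) hij
    · simpa [hg, directSum_castAdd, (Fin.strictMono_castAdd _).lt_iff_lt] using
        ho (Fin.castAdd b i) (Fin.castAdd b j)
    · simpa [hk] using hm (Fin.natAdd a i) (Fin.natAdd a j) (by simpa using hij)
    · simpa [hk, directSum_natAdd] using ho (Fin.natAdd a i) (Fin.natAdd a j)
    · simp only [φ]
      refine Fin.addCases (fun i => ?_) (fun i => ?_) i
      · simp [hg]
      · simp [hk]

lemma val_lt_of_cutOcc {x y z : SizedPerm} {j : ℕ} (hj : j ≤ x.1) (f : CutOcc x y z j) {i : ℕ}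
    (hi : i < j) : val x i < j := by
  obtain ⟨f, ⟨hm, ho⟩, hc⟩ := f
  have hlt : ∀ k ∈ Finset.Ico j x.1, val x k ∈ Finset.Ioo (val x i) x.1 := by
    intro k hk
    rw [Finset.mem_Ico] at hk
    rw [Finset.mem_Ioo]
    refine ⟨?_, (val_lt_iff x k).2 hk.2⟩
    have h1 := (hc ⟨i, by omega⟩).2 hi
    have h2 := (hc ⟨k, hk.2⟩).not.2 (by simp; omega)
    rw [val_of_lt x (by omega : i < x.1), val_of_lt x hk.2, ← Fin.lt_def, ho, Fin.lt_def,
      ← val_fin (dsum y z), ← val_fin (dsum y z), val_dsum, val_dsum, if_pos h1, if_neg h2]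
    have := (val_lt_iff y _).2 h1
    omega
  have := Finset.card_le_card_of_injOn (val x) hlt (val_injective x).injOn
  have h3 := (val_lt_iff x i).2 (by omega)
  simp only [Nat.card_Ico, Nat.card_Ioo] at this
  omega

lemma occ_dsum (x y z : SizedPerm) :
    occ x (dsum y z) = ∑ j ∈ Finset.range (x.1 + 1), Nat.card (CutOcc x y z j) := by
  classical
  have key : ∀ f : Fin x.1 → Fin (dsum y z).1, StrictMono f → ∀ j ≤ x.1,
      ((Finset.univ.filter fun i => (f i).val < y.1).card = j ↔
        ∀ i, (f i).val < y.1 ↔ i.val < j) := by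
    intro f hf j hj
    set T := Finset.univ.filter fun i => (f i).val < y.1 with hT
    have hc : ∀ i, (f i).val < y.1 ↔ i.val < T.card := by
      intro i
      constructor
      · intro hi
        have hsub : Finset.Iic i ⊆ T := fun l hl => by
          have h : (f l).val ≤ (f i).val := hf.monotone (Finset.mem_Iic.1 hl)
          simpa [hT] using h.trans_lt hi
        have := Finset.card_le_card hsub
        rw [Fin.card_Iic] at this
        omega
      · intro hi
        by_contra hi'
        have hsub : T ⊆ Finset.Iio i := fun l hl => by
          rw [Finset.mem_Iio]
          by_contra! hle
          have h : (f i).val ≤ (f l).val := hf.monotone hle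
          exact hi' (h.trans_lt (by simpa [hT] using hl))
        have := Finset.card_le_card hsub
        rw [Fin.card_Iio] at this
        omega
    have hT' : T.card ≤ x.1 := by simpa using Finset.card_le_univ T
    refine ⟨fun h => h ▸ hc, fun h => ?_⟩
    rcases lt_trichotomy T.card j with hlt | heq | hlt
    · have := ((hc ⟨T.card, by omega⟩).symm.trans (h _)).2 hlt
      simp at this
    · exact heq
    · have := ((hc ⟨j, by omega⟩).symm.trans (h _)).1 hlt
      simp at this
  unfold occ occCount
  rw [Nat.card_eq_fintype_card, Fintype.card_subtype,
    Finset.card_eq_sum_card_fiberwise (t := Finset.range (x.1 + 1))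
      (f := fun f => (Finset.univ.filter fun i => (f i).val < y.1).card)]
  · refine Finset.sum_congr rfl fun j hj => ?_
    unfold CutOcc
    rw [Nat.card_eq_fintype_card, Fintype.card_subtype, Finset.filter_filter]
    refine congrArg _ (Finset.filter_congr fun f _ => and_congr_right fun hf => ?_)
    exact key f hf.1 j (by simpa [Nat.lt_succ_iff] using hj)
  · intro f _
    simp only [Finset.coe_range, Set.mem_Iio]
    have := Finset.card_filter_le (Finset.univ : Finset (Fin x.1)) fun i => (f i).val < y.1
    simp only [Finset.card_univ, Fintype.card_fin] at this
    omega

lemma occ_ident_dsum (m : ℕ) {p : SizedPerm} (hp : 0 < p.1) (hd : ¬ SumDec p)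
    (y z : SizedPerm) :
    occ (dsum (ident m) p) (dsum y z) = occ (dsum (ident m) p) y +
      ∑ j ∈ Finset.range (m + 1), occ (ident j) y * occ (dsum (ident (m - j)) p) z := by
  have h1 : ∀ j ∈ Finset.range (m + 1), Nat.card (CutOcc (dsum (ident m) p) y z j) =
      occ (ident j) y * occ (dsum (ident (m - j)) p) z := by
    intro j hj
    rw [Finset.mem_range] at hj
    rw [← card_cutOcc_dsum, ← dsum_assoc, dsum_ident, size_ident, Nat.add_sub_cancel' (by omega)]
  have h2 : Nat.card (CutOcc (dsum (ident m) p) y z (m + p.1)) = occ (dsum (ident m) p) y := by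
    have := card_cutOcc_dsum (dsum (ident m) p) (ident 0) y z
    rwa [dsum_ident_zero, occ_of_size_zero (x := ident 0) rfl, mul_one] at this
  have h3 : ∀ j ∈ Finset.range (m + p.1), j ∉ Finset.range (m + 1) →
      Nat.card (CutOcc (dsum (ident m) p) y z j) = 0 := by
    intro j hj hj'
    rw [Finset.mem_range] at hj hj'
    have : IsEmpty (CutOcc (dsum (ident m) p) y z j) := by
      refine ⟨fun f => hd (sumDec_of_lt p (j := j - m) (by omega) (by omega) fun i hi => ?_)⟩
      have := val_lt_of_cutOcc (by simp; omega) f (i := m + i) (by omega)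
      rw [val_dsum, if_neg (by simp), size_ident, Nat.add_sub_cancel_left] at this
      omega
    exact Nat.card_of_isEmpty
  rw [occ_dsum, size_dsum, size_ident, Finset.sum_range_succ, h2,
    ← Finset.sum_subset (Finset.range_subset_range.2 (by omega)) h3, Finset.sum_congr rfl h1,
    add_comm]

open scoped Classical in
/-- Generating function of the weight `w` over the permutations satisfying `A`. -/
noncomputable def gf (A : SizedPerm → Prop) (w : SizedPerm → ℕ) : PowerSeries ℚ :=
  PowerSeries.mk fun n => ∑ σ : Perm (Fin n), if A ⟨n, σ⟩ then (w ⟨n, σ⟩ : ℚ) else 0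

/-- The separable permutations that are sum indecomposable. -/
def SepIndec (x : SizedPerm) : Prop := Sep x ∧ ¬ SumDec x

lemma pgf_eq (x : SizedPerm) : Pgf x.2 = gf Sep (occ x) := by
  ext n
  simp [Pgf, gf, sepPop, Sep, occ]
  rfl

lemma constantCoeff_gf {A : SizedPerm → Prop} (hA : ∀ x, A x → Sep x) (w : SizedPerm → ℕ) :
    PowerSeries.constantCoeff (gf A w) = 0 := by
  rw [← PowerSeries.coeff_zero_eq_constantCoeff_apply, gf, PowerSeries.coeff_mk]
  refine Finset.sum_eq_zero fun σ _ => if_neg fun h => ?_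
  exact lt_irrefl 0 (hA _ h).size_pos

lemma gf_compl (A : SizedPerm → Prop) (w : SizedPerm → ℕ) :
    gf (fun x => A (compl x)) (fun x => w (compl x)) = gf A w := by
  classical
  ext n
  simp only [gf, PowerSeries.coeff_mk]
  exact Equiv.sum_comp (Equiv.equivCongr (Equiv.refl (Fin n)) Fin.revPerm)
    fun σ : Perm (Fin n) => if A ⟨n, σ⟩ then (w ⟨n, σ⟩ : ℚ) else 0

lemma gf_congr {A B : SizedPerm → Prop} {v w : SizedPerm → ℕ} (hA : ∀ x, A x ↔ B x)
    (h : ∀ x, A x → v x = w x) : gf A v = gf B w := by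
  classical
  obtain rfl : A = B := funext fun x => propext (hA x)
  ext n
  simp only [gf, PowerSeries.coeff_mk]
  refine Finset.sum_congr rfl fun σ _ => ?_
  split_ifs with hσ
  · rw [h _ hσ]
  · rfl

/-- The permutations of length `n`. -/
def level (n : ℕ) : Finset SizedPerm := Finset.univ.map (Function.Embedding.sigmaMk n)

lemma mem_level {n : ℕ} {x : SizedPerm} : x ∈ level n ↔ x.1 = n := by
  obtain ⟨k, σ⟩ := x
  simp only [level, Finset.mem_map, Finset.mem_univ, true_and]
  constructor
  · rintro ⟨τ, h⟩
    exact (congrArg Sigma.fst h).symm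
  · rintro rfl
    exact ⟨σ, rfl⟩

open scoped Classical in
lemma coeff_gf (A : SizedPerm → Prop) (w : SizedPerm → ℕ) (n : ℕ) :
    PowerSeries.coeff n (gf A w) = ∑ x ∈ (level n).filter A, (w x : ℚ) := by
  rw [gf, PowerSeries.coeff_mk, Finset.sum_filter, level, Finset.sum_map]
  rfl

lemma gf_sep_eq_of_dsum {ι : Type*} (s : Finset ι) (f g : ι → SizedPerm → ℕ) (w : SizedPerm → ℕ)
    (h : ∀ y z, w (dsum y z) = ∑ i ∈ s, f i y * g i z) :
    gf Sep w = gf SepIndec w + ∑ i ∈ s, gf SepIndec (f i) * gf Sep (g i) := by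
  classical
  ext n
  have hsplit : ∑ x ∈ (level n).filter Sep, (w x : ℚ) =
      ∑ x ∈ (level n).filter SepIndec, (w x : ℚ) +
        ∑ x ∈ (level n).filter (fun x => Sep x ∧ SumDec x), (w x : ℚ) := by
    rw [← Finset.sum_filter_not_add_sum_filter _ SumDec, Finset.filter_filter,
      Finset.filter_filter]
    congr!
  have hdec : ∑ x ∈ (level n).filter (fun x => Sep x ∧ SumDec x), (w x : ℚ) =
      ∑ p ∈ (Finset.HasAntidiagonal.antidiagonal n).sigma
        (fun q => ((level q.1).filter SepIndec) ×ˢ ((level q.2).filter Sep)),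
        (w (dsum p.2.1 p.2.2) : ℚ) := by
    symm
    refine Finset.sum_bij (fun p _ => dsum p.2.1 p.2.2) ?_ ?_ ?_ fun _ _ => rfl
    · rintro ⟨⟨a, b⟩, y, z⟩ hp
      simp only [Finset.mem_sigma, Finset.HasAntidiagonal.mem_antidiagonal, Finset.mem_product,
        Finset.mem_filter, mem_level] at hp ⊢
      obtain ⟨hn, ⟨rfl, hy⟩, rfl, hz⟩ := hp
      exact ⟨hn, hy.1.dsum hz, y, z, hy.1.size_pos, hz.size_pos, rfl⟩
    · rintro ⟨⟨a, b⟩, y, z⟩ hp ⟨⟨a', b'⟩, y', z'⟩ hp' he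
      simp only [Finset.mem_sigma, Finset.HasAntidiagonal.mem_antidiagonal, Finset.mem_product,
        Finset.mem_filter, mem_level] at hp hp' he
      obtain ⟨-, ⟨rfl, hy⟩, rfl, -⟩ := hp
      obtain ⟨-, ⟨rfl, hy'⟩, rfl, -⟩ := hp'
      obtain ⟨rfl, rfl⟩ := dsum_inj_of_size he (le_antisymm
        (size_le_of_dsum_eq he.symm hy'.1.size_pos hy.2)
        (size_le_of_dsum_eq he hy.1.size_pos hy'.2))
      rfl
    · intro x hx
      simp only [Finset.mem_filter, mem_level] at hx
      obtain ⟨hn, hs, hd⟩ := hx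
      obtain ⟨y, z, hy, hz, rfl⟩ := hs.exists_first hd
      refine ⟨⟨(y.1, z.1), (y, z)⟩, ?_, rfl⟩
      simp only [Finset.mem_sigma, Finset.HasAntidiagonal.mem_antidiagonal, Finset.mem_product,
        Finset.mem_filter, mem_level]
      exact ⟨hn, ⟨trivial, hy⟩, trivial, hz⟩
  simp only [map_add, map_sum, PowerSeries.coeff_mul, coeff_gf]
  rw [hsplit, hdec, Finset.sum_sigma, Finset.sum_comm]
  refine congrArg _ (Finset.sum_congr rfl fun q _ => ?_)
  simp only [h, Nat.cast_sum, Nat.cast_mul, Finset.sum_mul_sum]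
  rw [Finset.sum_comm]
  refine Finset.sum_congr rfl fun i _ => ?_
  rw [Finset.sum_product]

/-- Generating function of the separable permutations. -/
noncomputable def sepGf : PowerSeries ℚ := gf Sep fun _ => 1

/-- Popularity of the identity pattern in sum indecomposable separable permutations. -/
noncomputable def identGf (m : ℕ) : PowerSeries ℚ := gf SepIndec (occ (ident m))

lemma gf_occ_ident_dsum (m : ℕ) {p : SizedPerm} (hp : 0 < p.1) (hd : ¬ SumDec p) :
    gf Sep (occ (dsum (ident m) p)) = gf SepIndec (occ (dsum (ident m) p)) * (1 + sepGf) +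
      ∑ j ∈ Finset.range (m + 1), identGf j * gf Sep (occ (dsum (ident (m - j)) p)) := by
  rw [gf_sep_eq_of_dsum (Finset.insertNone (Finset.range (m + 1)))
    (fun o => o.elim (occ (dsum (ident m) p)) fun j => occ (ident j))
    (fun o => o.elim (fun _ => 1) fun j => occ (dsum (ident (m - j)) p))
    (occ (dsum (ident m) p))]
  · rw [Finset.sum_insertNone]
    simp only [Option.elim_none, Option.elim_some, sepGf, identGf]
    ring
  · intro y z
    rw [occ_ident_dsum m hp hd, Finset.sum_insertNone]
    simp

lemma gf_sep_eq_add_compl {p : SizedPerm} (hp : 1 < p.1) :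
    gf Sep (occ p) = gf SepIndec (occ p) + gf SepIndec (occ (compl p)) := by
  classical
  rw [← gf_compl SepIndec (occ (compl p))]
  ext n
  simp only [gf, map_add, PowerSeries.coeff_mk, ← Finset.sum_add_distrib, occ_compl]
  refine Finset.sum_congr rfl fun σ _ => ?_
  by_cases hs : Sep ⟨n, σ⟩
  · by_cases h1 : n ≤ 1
    · have : occ p ⟨n, σ⟩ = 0 := occ_of_size_lt (h1.trans_lt hp)
      simp [this]
    · rcases hs.trichotomy with h | h | h
      · simp only at h
        omega
      · simp [SepIndec, sep_compl_iff, hs, h, h.not_compl]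
      · have h' : ¬ SumDec ⟨n, σ⟩ := fun h' => h'.not_compl h
        simp [SepIndec, sep_compl_iff, hs, h, h']
  · simp [SepIndec, sep_compl_iff, hs]

lemma gf_occ_recurrence (m : ℕ) {p : SizedPerm} (hp : 0 < p.1) (hd : ¬ SumDec p) :
    (1 - 2 * identGf 0 - sepGf) * gf Sep (occ (dsum (ident (m + 1)) p)) =
      ∑ i ∈ Finset.range (m + 1), identGf (m + 1 - i) * gf Sep (occ (dsum (ident i) p)) := by
  set q := dsum (ident (m + 1)) p with hq
  have hsize : 1 < q.1 := by simp [hq]; omega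
  have hdec : SumDec q := ⟨ident (m + 1), p, by simp, hp, rfl⟩
  have h1 := gf_occ_ident_dsum (m + 1) hp hd
  have h2 := gf_occ_ident_dsum 0 (p := compl q) (by simp; omega) hdec.not_compl
  have h3 := gf_sep_eq_add_compl hsize
  have h4 : gf Sep (occ (compl q)) = gf Sep (occ q) := by
    rw [← gf_compl Sep]
    exact gf_congr (fun _ => sep_compl_iff) fun x _ => occ_compl q x
  have h5 : ∑ i ∈ Finset.range (m + 1), identGf (m + 1 - i) * gf Sep (occ (dsum (ident i) p)) =
      ∑ j ∈ Finset.range (m + 1),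
        identGf (j + 1) * gf Sep (occ (dsum (ident (m + 1 - (j + 1))) p)) := by
    rw [← Finset.sum_range_reflect]
    refine Finset.sum_congr rfl fun j hj => ?_
    rw [Finset.mem_range] at hj
    rw [show m + 1 - (m + 1 - 1 - j) = j + 1 by omega,
      show m + 1 - 1 - j = m + 1 - (j + 1) by omega]
  rw [Finset.sum_range_succ'] at h1
  simp only [zero_add, Finset.sum_range_one, Nat.sub_zero, ident_zero_dsum, h4] at h2
  rw [h5]
  simp only [Nat.sub_zero, ← hq] at h1
  linear_combination h1 + h2 - (1 + sepGf) * h3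

lemma exists_factor (m : ℕ) : ∃ F : PowerSeries ℚ, ∀ p : SizedPerm, 0 < p.1 → ¬ SumDec p →
    gf Sep (occ (dsum (ident m) p)) = F * gf Sep (occ p) := by
  induction m using Nat.strong_induction_on with
  | _ m ih =>
    cases m with
    | zero => exact ⟨1, fun p _ _ => by rw [ident_zero_dsum, one_mul]⟩
    | succ m =>
      choose! F hF using ih
      set K : PowerSeries ℚ := 1 - 2 * identGf 0 - sepGf with hK
      have hK0 : PowerSeries.constantCoeff K ≠ 0 := by
        simp [hK, identGf, sepGf, constantCoeff_gf (A := SepIndec) (fun _ h => h.1),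
          constantCoeff_gf (A := Sep) (fun _ h => h)]
      refine ⟨K⁻¹ * ∑ i ∈ Finset.range (m + 1), identGf (m + 1 - i) * F i, fun p hp hd => ?_⟩
      rw [mul_assoc, Finset.sum_mul, ← one_mul (gf Sep (occ (dsum _ p))),
        ← PowerSeries.inv_mul_cancel K hK0, mul_assoc, gf_occ_recurrence m hp hd]
      congr 1
      refine Finset.sum_congr rfl fun i hi => ?_
      rw [hF i (Finset.mem_range.1 hi) p hp hd, mul_assoc]

lemma not_sumDec_of_sumIndecomposable {a : ℕ} {π : Perm (Fin a)} (h : SumIndecomposable π) :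
    ¬ SumDec ⟨a, π⟩ := by
  rintro ⟨⟨b, σ⟩, ⟨c, τ⟩, hb, hc, e⟩
  cases e
  exact h ⟨b, c, rfl, σ, τ, hb, hc, rfl⟩

end SizedPerm

/-- There is a family of power series `F_m`, independent of `π`, such that for every sum
indecomposable separable permutation `π`, `P_{I(m) ⊕ π} = F_m · P_π`. -/
theorem factorization_of_popularity_gf :
    ∃ F : ℕ → PowerSeries ℚ,
      ∀ (m a : ℕ) (π : Perm (Fin a)), IsSepPerm π → SumIndecomposable π →
        Pgf (directSum (1 : Perm (Fin m)) π) = F m * Pgf π := by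
  choose F hF using SizedPerm.exists_factor
  refine ⟨F, fun m a π hs hi => ?_⟩
  have h := hF m ⟨a, π⟩ (SizedPerm.Sep.size_pos (x := ⟨a, π⟩) hs)
    (SizedPerm.not_sumDec_of_sumIndecomposable hi)
  rwa [← SizedPerm.pgf_eq, ← SizedPerm.pgf_eq] at h
end
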